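/- Let 𝒯 be a family of distinct 3-sets with |U(𝒯)| = n ≥ 4 and |𝒯| ≥ ⌊n/2⌋ + 1. Then every union-closed family 𝔉 with 𝒯 ⊆ 𝔉 satisfies Frankl's conjecture: there exists i ∈ U(𝔉) with 2·|𝔉_i| ≥ |𝔉|. -/

import Mathlib

/-- A family of sets is union-closed. -/
def UC (F : Finset (Finset ℕ)) : Prop := ∀ A ∈ F, ∀ B ∈ F, A ∪ B ∈ F

/-- `famU F` is the union `U(F)` of all members of the family `F`. -/
def famU (F : Finset (Finset ℕ)) : Finset ℕ := F.sup id

/-- `memFam F i` is the subfamily `F_i` of sets in `F` containing `i`. -/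
def memFam (F : Finset (Finset ℕ)) (i : ℕ) : Finset (Finset ℕ) :=
  F.filter (fun S => i ∈ S)

/-- The mask of `A` with respect to the list of points `l`: bit `i` records whether `l[i] ∈ A`. -/
def mask (l : List ℕ) (A : Finset ℕ) : ℕ :=
  l.foldr (fun a r => Nat.bit (decide (a ∈ A)) r) 0

/-- The set of those points of `l` whose bit is set in `Y`. -/
def maskSet : List ℕ → ℕ → Finset ℕ
  | [], _ => ∅
  | a :: l, Y => bif Y.testBit 0 then insert a (maskSet l (Y / 2)) else maskSet l (Y / 2)

@[simp] theorem mask_nil (A : Finset ℕ) : mask [] A = 0 := rfl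

@[simp] theorem mask_cons (a : ℕ) (l : List ℕ) (A : Finset ℕ) :
    mask (a :: l) A = Nat.bit (decide (a ∈ A)) (mask l A) := rfl

theorem mask_lt (l : List ℕ) (A : Finset ℕ) : mask l A < 2 ^ l.length := by
  induction l with
  | nil => simp
  | cons a l ih =>
    rw [mask_cons, List.length_cons, pow_succ]
    cases decide (a ∈ A) <;> simp [Nat.bit] <;> omega

theorem testBit_mask (l : List ℕ) (A : Finset ℕ) (i : ℕ) :
    (mask l A).testBit i = (l[i]?).any (fun a => decide (a ∈ A)) := by
  induction l generalizing i with
  | nil => simp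
  | cons a l ih => cases i <;> simp [Nat.testBit_bit_succ, ih]

theorem maskSet_or (l : List ℕ) (Y Z : ℕ) : maskSet l (Y ||| Z) = maskSet l Y ∪ maskSet l Z := by
  induction l generalizing Y Z with
  | nil => rfl
  | cons a l ih =>
    simp only [maskSet, Nat.testBit_or, Nat.or_div_two, ih]
    cases Y.testBit 0 <;> cases Z.testBit 0 <;> ext x <;> simp

theorem maskSet_subset (l : List ℕ) (Y : ℕ) : maskSet l Y ⊆ l.toFinset := by
  induction l generalizing Y with
  | nil => simp [maskSet]
  | cons a l ih =>
    have := ih (Y / 2)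
    rw [maskSet, List.toFinset_cons]
    cases Y.testBit 0
    · exact this.trans (Finset.subset_insert _ _)
    · exact Finset.insert_subset_insert _ this

theorem maskSet_mask (l : List ℕ) (A : Finset ℕ) : maskSet l (mask l A) = A ∩ l.toFinset := by
  induction l with
  | nil => simp [maskSet]
  | cons a l ih =>
    rw [maskSet, mask_cons, Nat.testBit_bit_zero, Nat.bit_div_two, ih]
    by_cases h : a ∈ A <;> ext x <;> simp [h]

theorem mask_union_maskSet {l : List ℕ} (hl : l.Nodup) {X : Finset ℕ}
    (hX : Disjoint X l.toFinset) {Y : ℕ} (hY : Y < 2 ^ l.length) :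
    mask l (X ∪ maskSet l Y) = Y := by
  induction l generalizing X Y with
  | nil => simp at hY; simp [hY]
  | cons a l ih =>
    rw [List.nodup_cons] at hl
    rw [List.toFinset_cons, Finset.disjoint_insert_right] at hX
    have hY' : Y / 2 < 2 ^ l.length := by
      rw [List.length_cons, pow_succ] at hY; omega
    have ha : a ∉ maskSet l (Y / 2) := fun h => hl.1 (by simpa using maskSet_subset _ _ h)
    rw [mask_cons, maskSet]
    cases hb : Y.testBit 0
    · rw [cond_false, ih hl.2 hX.2 hY']
      simp [hX.1, ha]
      simp at hb
      omega
    · have hins : X ∪ insert a (maskSet l (Y / 2)) = insert a X ∪ maskSet l (Y / 2) := by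
        ext; simp
      rw [cond_true, hins, ih hl.2 (by simp [hX.2, hl.1]) hY']
      simp [Nat.bit]
      simp at hb
      omega

/-- The number of members of `F` with mask `Y`. -/
def maskCount (F : Finset (Finset ℕ)) (l : List ℕ) (Y : ℕ) : ℕ :=
  (F.filter (fun A => mask l A = Y)).card

/-- The traces outside `l` of those members of `F` that meet `l` in `maskSet l Y`. -/
def maskFiber (F : Finset (Finset ℕ)) (l : List ℕ) (Y : ℕ) : Finset (Finset ℕ) :=
  (F.image (· \ l.toFinset)).filter (fun X => X ∪ maskSet l Y ∈ F)

theorem card_maskFiber (F : Finset (Finset ℕ)) {l : List ℕ} (hl : l.Nodup) {Y : ℕ}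
    (hY : Y < 2 ^ l.length) : maskCount F l Y = (maskFiber F l Y).card := by
  have key : ∀ A, mask l A = Y → A \ l.toFinset ∪ maskSet l Y = A := by
    rintro A rfl
    rw [maskSet_mask, Finset.sdiff_union_inter]
  refine Finset.card_nbij' (· \ l.toFinset) (· ∪ maskSet l Y) ?_ ?_ ?_ ?_
  · intro A hA
    simp only [Finset.coe_filter, Set.mem_ofPred_eq] at hA
    simp only [maskFiber, Finset.coe_filter, Set.mem_ofPred_eq, key A hA.2]
    exact ⟨Finset.mem_image_of_mem _ hA.1, hA.1⟩
  · intro X hX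
    simp only [maskFiber, Finset.coe_filter, Set.mem_ofPred_eq, Finset.mem_image] at hX
    obtain ⟨⟨B, -, rfl⟩, h⟩ := hX
    simp only [Finset.coe_filter, Set.mem_ofPred_eq]
    exact ⟨h, mask_union_maskSet hl Finset.sdiff_disjoint hY⟩
  · intro A hA
    simp only [Finset.coe_filter, Set.mem_ofPred_eq] at hA
    exact key A hA.2
  · intro X hX
    simp only [maskFiber, Finset.coe_filter, Set.mem_ofPred_eq, Finset.mem_image] at hX
    obtain ⟨⟨B, -, rfl⟩, h⟩ := hX
    have := maskSet_subset l Y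
    ext x
    have := @this x
    simp at this ⊢
    tauto

/-- Adjoin to `Y` all edges contained in `W`. -/
def reach (E : List ℕ) (Y W : ℕ) : ℕ :=
  E.foldl (fun r e => bif (e &&& W) == e then r ||| e else r) Y

theorem union_maskSet_reach {F : Finset (Finset ℕ)} (hF : UC F) (l : List ℕ) (E : List ℕ)
    (hE : ∀ e ∈ E, maskSet l e ∈ F) (X : Finset ℕ) (W Y : ℕ) (hY : X ∪ maskSet l Y ∈ F) :
    X ∪ maskSet l (reach E Y W) ∈ F := by
  induction E generalizing Y with
  | nil => exact hY
  | cons e E ih =>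
    rw [List.forall_mem_cons] at hE
    refine ih hE.2 _ ?_
    beta_reduce
    cases (e &&& W) == e
    · exact hY
    · rw [cond_true, maskSet_or, ← Finset.union_assoc]
      exact hF _ hY _ hE.1

theorem maskCount_add_le {F : Finset (Finset ℕ)} (hF : UC F) {l : List ℕ} (hl : l.Nodup)
    {E : List ℕ} (hE : ∀ e ∈ E, maskSet l e ∈ F) {Y Z W : ℕ}
    (hY : Y < 2 ^ l.length) (hZ : Z < 2 ^ l.length) (hW : W < 2 ^ l.length)
    (hYW : reach E Y W = W) (hZW : reach E Z W = W) :
    maskCount F l Y + maskCount F l Z ≤ maskCount F l (Y ||| Z) + maskCount F l W := by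
  rw [card_maskFiber F hl hY, card_maskFiber F hl hZ, card_maskFiber F hl hW,
    card_maskFiber F hl (Nat.or_lt_two_pow hY hZ), ← Finset.card_union_add_card_inter, add_comm]
  gcongr
  · intro X hX
    simp only [maskFiber, Finset.mem_inter, Finset.mem_filter] at hX ⊢
    refine ⟨hX.1.1, ?_⟩
    obtain ⟨B, -, hB⟩ := Finset.mem_image.1 hX.1.1
    rw [maskSet_or, Finset.union_union_distrib_left]
    exact hF _ hX.1.2 _ hX.2.2
  · intro X hX
    simp only [maskFiber, Finset.mem_union, Finset.mem_filter] at hX ⊢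
    rcases hX with hX | hX
    · exact ⟨hX.1, hYW ▸ union_maskSet_reach hF l E hE X W Y hX.2⟩
    · exact ⟨hX.1, hZW ▸ union_maskSet_reach hF l E hE X W Z hX.2⟩

theorem sum_mask (F : Finset (Finset ℕ)) (l : List ℕ) (f : ℕ → ℤ) :
    ∑ A ∈ F, f (mask l A) = ∑ Y ∈ Finset.range (2 ^ l.length), maskCount F l Y * f Y := by
  rw [← Finset.sum_fiberwise_of_maps_to (t := Finset.range (2 ^ l.length)) (g := mask l)
    (fun A _ => Finset.mem_range.2 (mask_lt l A))]
  refine Finset.sum_congr rfl fun Y _ => ?_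
  rw [Finset.sum_congr rfl (g := fun _ => f Y) (by simp +contextual), Finset.sum_const, maskCount,
    nsmul_eq_mul]

/-- The value at `x` of the linear functional with the given list of (coefficient, index). -/
def evalTerms {R : Type*} [Semiring R] (L : List (ℕ × ℕ)) (x : ℕ → R) : R :=
  (L.map (fun t => (t.1 : R) * x t.2)).sum

/-- The coefficient of index `i`. -/
def termCoeff (L : List (ℕ × ℕ)) (i : ℕ) : ℕ :=
  (L.map (fun t => bif t.2 == i then t.1 else 0)).sum

theorem termCoeff_le (L : List (ℕ × ℕ)) (i : ℕ) : termCoeff L i ≤ (L.map Prod.fst).sum := by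
  refine List.sum_le_sum fun t _ => ?_
  cases t.2 == i <;> simp

theorem evalTerms_eq_sum {R : Type*} [Semiring R] {M : ℕ} (L : List (ℕ × ℕ))
    (h : ∀ t ∈ L, t.2 < M) (x : ℕ → R) :
    evalTerms L x = ∑ i ∈ Finset.range M, (termCoeff L i : R) * x i := by
  induction L with
  | nil => simp [evalTerms, termCoeff]
  | cons t L ih =>
    rw [List.forall_mem_cons] at h
    have ih := ih h.2
    have h0 : ∑ i ∈ Finset.range M, ((bif t.2 == i then t.1 else 0 : ℕ) : R) * x i
        = t.1 * x t.2 := by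
      rw [Finset.sum_eq_single_of_mem t.2 (Finset.mem_range.2 h.1)]
      · simp
      · intro i _ hi
        simp [beq_false_of_ne hi.symm]
    simp only [evalTerms, termCoeff, List.map_cons, List.sum_cons, Nat.cast_add, add_mul,
      Finset.sum_add_distrib] at ih ⊢
    rw [ih, h0]

theorem sum_mul_pow_injective {B : ℕ} (M : ℕ) (a b : ℕ → ℕ) (ha : ∀ i, a i < B)
    (hb : ∀ i, b i < B)
    (h : ∑ i ∈ Finset.range M, a i * B ^ i = ∑ i ∈ Finset.range M, b i * B ^ i) :
    ∀ i < M, a i = b i := by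
  induction M generalizing a b with
  | zero => simp
  | succ M ih =>
    have split : ∀ c : ℕ → ℕ, ∑ i ∈ Finset.range (M + 1), c i * B ^ i
        = c 0 + B * ∑ i ∈ Finset.range M, c (i + 1) * B ^ i := by
      intro c
      rw [Finset.sum_range_succ', Finset.mul_sum, add_comm]
      simp only [pow_zero, mul_one, pow_succ]
      congr 1
      exact Finset.sum_congr rfl fun i _ => by ring
    rw [split, split] at h
    have h0 : a 0 = b 0 := by
      have := congrArg (· % B) h
      simpa [Nat.mod_eq_of_lt (ha 0), Nat.mod_eq_of_lt (hb 0)] using this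
    have hB : 0 < B := (Nat.zero_le _).trans_lt (ha 0)
    rw [h0] at h
    have h' := Nat.eq_of_mul_eq_mul_left hB (Nat.add_left_cancel h)
    rintro (_ | i) hi
    · exact h0
    · exact ih (fun i => a (i + 1)) (fun i => b (i + 1)) (fun i => ha _) (fun i => hb _) h' i
        (by omega)

/-- Functionals with small coefficients are determined by their value at a geometric sequence. -/
theorem evalTerms_congr {B : ℕ} {L₁ L₂ : List (ℕ × ℕ)} (h₁ : (L₁.map Prod.fst).sum < B)
    (h₂ : (L₂.map Prod.fst).sum < B)
    (h : evalTerms L₁ (fun i => B ^ i) = evalTerms L₂ (fun i => B ^ i)) (x : ℕ → ℤ) :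
    evalTerms L₁ x = evalTerms L₂ x := by
  obtain ⟨M, hM⟩ : ∃ M, ∀ t ∈ L₁ ++ L₂, t.2 < M :=
    ⟨((L₁ ++ L₂).map Prod.snd).sum + 1, fun t ht =>
      Nat.lt_succ_of_le (List.le_sum_of_mem (List.mem_map_of_mem ht))⟩
  rw [List.forall_mem_append] at hM
  rw [evalTerms_eq_sum L₁ hM.1, evalTerms_eq_sum L₂ hM.2] at h ⊢
  have := sum_mul_pow_injective M _ _ (fun i => (termCoeff_le L₁ i).trans_lt h₁)
    (fun i => (termCoeff_le L₂ i).trans_lt h₂) (by exact_mod_cast h)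
  exact Finset.sum_congr rfl fun i hi => by rw [this i (Finset.mem_range.1 hi)]

theorem evalTerms_append {R : Type*} [Semiring R] (L₁ L₂ : List (ℕ × ℕ)) (x : ℕ → R) :
    evalTerms (L₁ ++ L₂) x = evalTerms L₁ x + evalTerms L₂ x := by
  simp [evalTerms]

/-- A cut `⟨c, Y, Z, W⟩` stands for `c` times `x Y + x Z ≤ x (Y ||| Z) + x W`. -/
structure Cut where
  coeff : ℕ
  left : ℕ
  right : ℕ
  top : ℕ

/-- The image of a mask under the map of positions `i ↦ p[i]`. -/
def permMask : List ℕ → ℕ → ℕ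
  | [], _ => 0
  | v :: p, Y => bif Y.testBit 0 then 2 ^ v + permMask p (Y / 2) else permMask p (Y / 2)

/-- The image of a cut under a map of positions. -/
def Cut.perm (p : List ℕ) (c : Cut) : Cut :=
  ⟨c.coeff, permMask p c.left, permMask p c.right, permMask p c.top⟩

/-- All images of the cuts in `C` under the maps in `P`. -/
def expand (P : List (List ℕ)) (C : List Cut) : List Cut :=
  P.flatMap fun p => C.map (Cut.perm p)

/-- Validity of a cut for union-closed families on `n` points containing the edges `E`. -/
def Cut.valid (n : ℕ) (E : List ℕ) (c : Cut) : Bool :=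
  Nat.blt c.left (2 ^ n) && Nat.blt c.right (2 ^ n) && Nat.blt c.top (2 ^ n) &&
    reach E c.left c.top == c.top && reach E c.right c.top == c.top

/-- The left-hand sides of cuts. -/
def lowerTerms (C : List Cut) : List (ℕ × ℕ) :=
  C.flatMap fun c => [(c.coeff, c.left), (c.coeff, c.right)]

/-- The right-hand sides of cuts. -/
def upperTerms (C : List Cut) : List (ℕ × ℕ) :=
  C.flatMap fun c => [(c.coeff, c.left ||| c.right), (c.coeff, c.top)]

/-- A functional as a list of terms. -/
def funTerms (n : ℕ) (f : ℕ → ℤ) : List (ℕ × ℕ) :=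
  (List.range (2 ^ n)).map fun Y => ((f Y).toNat, Y)

/-- `checkCert n E B d f C` verifies that `d` times the functional `f` is the sum of the cuts `C`,
comparing coefficients in base `B`. -/
def checkCert (n : ℕ) (E : List ℕ) (B d : ℕ) (f : ℕ → ℤ) (C : List Cut) : Bool :=
  let L := lowerTerms C ++ funTerms n fun Y => d * f Y
  let R := upperTerms C ++ funTerms n fun Y => d * -f Y
  Nat.blt 0 d && C.all (Cut.valid n E) && Nat.blt (L.map Prod.fst).sum B &&
    Nat.blt (R.map Prod.fst).sum B &&
    evalTerms L (fun i => B ^ i) == evalTerms R (fun i => B ^ i)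

theorem evalTerms_funTerms (n : ℕ) (f x : ℕ → ℤ) :
    evalTerms (funTerms n f) x = ∑ Y ∈ Finset.range (2 ^ n), ((f Y).toNat : ℤ) * x Y := by
  rw [evalTerms, funTerms, List.map_map, ← List.sum_toFinset _ List.nodup_range,
    List.toFinset_range]
  rfl

theorem evalTerms_lower_le_upper {F : Finset (Finset ℕ)} (hF : UC F) {l : List ℕ} (hl : l.Nodup)
    {E : List ℕ} (hE : ∀ e ∈ E, maskSet l e ∈ F) (C : List Cut)
    (hC : C.all (Cut.valid l.length E) = true) :
    evalTerms (lowerTerms C) (fun i => (maskCount F l i : ℤ))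
      ≤ evalTerms (upperTerms C) (fun i => (maskCount F l i : ℤ)) := by
  induction C with
  | nil => rfl
  | cons c C ih =>
    rw [List.all_cons, Bool.and_eq_true] at hC
    have ih := ih hC.2
    have h := hC.1
    simp only [Cut.valid, Bool.and_eq_true, Nat.blt_eq, beq_iff_eq] at h
    obtain ⟨⟨⟨⟨h1, h2⟩, h3⟩, h4⟩, h5⟩ := h
    have key := maskCount_add_le hF hl hE h1 h2 h3 h4 h5
    have key' : (c.coeff : ℤ) * (maskCount F l c.left + maskCount F l c.right)
        ≤ c.coeff * (maskCount F l (c.left ||| c.right) + maskCount F l c.top) := by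
      exact_mod_cast Nat.mul_le_mul_left _ key
    simp only [evalTerms, lowerTerms, upperTerms, List.flatMap_cons, List.map_append,
      List.sum_append, List.map_cons, List.map_nil, List.sum_cons, List.sum_nil] at ih ⊢
    linarith

theorem sum_mask_nonneg_of_checkCert {F : Finset (Finset ℕ)} (hF : UC F) {l : List ℕ}
    (hl : l.Nodup) {E : List ℕ} (hE : ∀ e ∈ E, maskSet l e ∈ F) {B d : ℕ} {f : ℕ → ℤ}
    {C : List Cut} (h : checkCert l.length E B d f C = true) :
    0 ≤ ∑ A ∈ F, f (mask l A) := by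
  simp only [checkCert, Bool.and_eq_true, Nat.blt_eq, beq_iff_eq] at h
  obtain ⟨⟨⟨⟨hd, hC⟩, h1⟩, h2⟩, h3⟩ := h
  have h4 := evalTerms_congr h1 h2 h3 fun i => (maskCount F l i : ℤ)
  rw [evalTerms_append, evalTerms_append, evalTerms_funTerms, evalTerms_funTerms] at h4
  have h5 := evalTerms_lower_le_upper hF hl hE C hC
  have h7 : (d : ℤ) * ∑ A ∈ F, f (mask l A)
      = ∑ Y ∈ Finset.range (2 ^ l.length), ((d * f Y).toNat : ℤ) * maskCount F l Y
        - ∑ Y ∈ Finset.range (2 ^ l.length), ((d * -f Y).toNat : ℤ) * maskCount F l Y := by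
    rw [sum_mask, Finset.mul_sum, ← Finset.sum_sub_distrib]
    refine Finset.sum_congr rfl fun Y _ => ?_
    rw [← sub_mul, mul_neg, Int.toNat_sub_toNat_neg]
    ring
  have h8 : 0 ≤ (d : ℤ) * ∑ A ∈ F, f (mask l A) := by linarith
  exact nonneg_of_mul_nonneg_right h8 (by exact_mod_cast hd)

/-- The functional that counts a present point with its weight and an absent one with minus it. -/
def weightFun : List ℕ → ℕ → ℤ
  | [], _ => 0
  | v :: w, Y => (bif Y.testBit 0 then (v : ℤ) else -v) + weightFun w (Y / 2)

/-- A union-closed family in which every element lies in less than half of the members. -/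
structure Counterexample (F : Finset (Finset ℕ)) : Prop where
  uc : UC F
  lt : ∀ i, 2 * (memFam F i).card < F.card

theorem Counterexample.sum_weightFun_le {F : Finset (Finset ℕ)} (hF : Counterexample F)
    (w l : List ℕ) (h : w.length = l.length) :
    ∑ A ∈ F, weightFun w (mask l A) ≤ -(w.sum : ℤ) := by
  induction w generalizing l with
  | nil => simp [weightFun]
  | cons v w ih =>
    obtain _ | ⟨a, l⟩ := l
    · simp at h
    have ih := ih l (by simpa using h)
    have ha : ∑ A ∈ F, (bif decide (a ∈ A) then (v : ℤ) else -v)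
        = v * (2 * (memFam F a).card - F.card) := by
      have h1 : ∀ A ∈ F, (bif decide (a ∈ A) then (v : ℤ) else -v)
          = 2 * v * (if a ∈ A then 1 else 0) - v := by
        intro A _
        by_cases h : a ∈ A
        · simp [h]
          ring
        · simp [h]
      rw [Finset.sum_congr rfl h1, Finset.sum_sub_distrib, ← Finset.mul_sum, Finset.sum_boole,
        Finset.sum_const, memFam, nsmul_eq_mul]
      ring
    have hv : (v : ℤ) * (2 * (memFam F a).card - F.card) ≤ v * (-1) := by
      have := hF.lt a
      gcongr
      omega
    simp only [mask_cons, weightFun, Nat.testBit_bit_zero, Nat.bit_div_two, Finset.sum_add_distrib,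
      ha, List.sum_cons, Nat.cast_add]
    linarith

theorem Counterexample.false_of_checkCert {F : Finset (Finset ℕ)} (hF : Counterexample F)
    {l : List ℕ} (hl : l.Nodup) {E : List ℕ} (hE : ∀ e ∈ E, maskSet l e ∈ F) {B d : ℕ}
    {w : List ℕ} (hw : w.length = l.length) (hw' : 0 < w.sum) {C : List Cut}
    (h : checkCert l.length E B d (weightFun w) C = true) : False := by
  have h1 := sum_mask_nonneg_of_checkCert hF.uc hl hE h
  have h2 := hF.sum_weightFun_le w l hw
  omega

/-- Symmetries of the shape with edges 012 034 056. -/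
def flowerPerms : List (List ℕ) :=
  [[0, 1, 2, 3, 4, 5, 6], [0, 1, 2, 3, 4, 6, 5], [0, 1, 2, 4, 3, 5, 6], [0, 1, 2, 4, 3, 6, 5],
   [0, 1, 2, 5, 6, 3, 4], [0, 1, 2, 5, 6, 4, 3], [0, 1, 2, 6, 5, 3, 4], [0, 1, 2, 6, 5, 4, 3],
   [0, 2, 1, 3, 4, 5, 6], [0, 2, 1, 3, 4, 6, 5], [0, 2, 1, 4, 3, 5, 6], [0, 2, 1, 4, 3, 6, 5],
   [0, 2, 1, 5, 6, 3, 4], [0, 2, 1, 5, 6, 4, 3], [0, 2, 1, 6, 5, 3, 4], [0, 2, 1, 6, 5, 4, 3],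
   [0, 3, 4, 1, 2, 5, 6], [0, 3, 4, 1, 2, 6, 5], [0, 3, 4, 2, 1, 5, 6], [0, 3, 4, 2, 1, 6, 5],
   [0, 3, 4, 5, 6, 1, 2], [0, 3, 4, 5, 6, 2, 1], [0, 3, 4, 6, 5, 1, 2], [0, 3, 4, 6, 5, 2, 1],
   [0, 4, 3, 1, 2, 5, 6], [0, 4, 3, 1, 2, 6, 5], [0, 4, 3, 2, 1, 5, 6], [0, 4, 3, 2, 1, 6, 5],
   [0, 4, 3, 5, 6, 1, 2], [0, 4, 3, 5, 6, 2, 1], [0, 4, 3, 6, 5, 1, 2], [0, 4, 3, 6, 5, 2, 1],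
   [0, 5, 6, 1, 2, 3, 4], [0, 5, 6, 1, 2, 4, 3], [0, 5, 6, 2, 1, 3, 4], [0, 5, 6, 2, 1, 4, 3],
   [0, 5, 6, 3, 4, 1, 2], [0, 5, 6, 3, 4, 2, 1], [0, 5, 6, 4, 3, 1, 2], [0, 5, 6, 4, 3, 2, 1],
   [0, 6, 5, 1, 2, 3, 4], [0, 6, 5, 1, 2, 4, 3], [0, 6, 5, 2, 1, 3, 4], [0, 6, 5, 2, 1, 4, 3],
   [0, 6, 5, 3, 4, 1, 2], [0, 6, 5, 3, 4, 2, 1], [0, 6, 5, 4, 3, 1, 2], [0, 6, 5, 4, 3, 2, 1]]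

/-- Cuts certifying the shape with edges 012 034 056. -/
def flowerCuts : List Cut :=
  [⟨2, 6, 120, 127⟩, ⟨10, 2, 2, 27⟩, ⟨6, 15, 105, 111⟩, ⟨1, 31, 103, 127⟩, ⟨2, 1, 2, 7⟩,
   ⟨8, 3, 10, 27⟩, ⟨2, 6, 24, 31⟩, ⟨6, 14, 104, 111⟩, ⟨16, 10, 10, 107⟩, ⟨6, 2, 25, 31⟩,
   ⟨8, 11, 42, 107⟩, ⟨4, 0, 0, 7⟩]

theorem flower_check : checkCert 7 [7, 25, 97] (2 ^ 32) 24
    (weightFun [2, 1, 1, 1, 1, 1, 1])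
    (expand flowerPerms flowerCuts) = true := by
  decide +kernel

/-- Symmetries of the shape with edges 012 013 045. -/
def fanDisjointPerms : List (List ℕ) :=
  [[0, 1, 2, 3, 4, 5], [0, 1, 2, 3, 5, 4], [0, 1, 3, 2, 4, 5], [0, 1, 3, 2, 5, 4]]

/-- Cuts certifying the shape with edges 012 013 045. -/
def fanDisjointCuts : List Cut :=
  [⟨4, 4, 49, 55⟩, ⟨6, 18, 20, 23⟩, ⟨8, 1, 16, 49⟩, ⟨2, 21, 25, 31⟩, ⟨2, 3, 18, 51⟩,
   ⟨2, 4, 56, 63⟩, ⟨1, 7, 11, 15⟩, ⟨2, 6, 50, 55⟩, ⟨6, 20, 24, 31⟩, ⟨2, 7, 19, 55⟩,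
   ⟨12, 17, 28, 31⟩, ⟨20, 0, 0, 7⟩, ⟨2, 2, 2, 51⟩, ⟨10, 4, 58, 63⟩, ⟨18, 16, 16, 23⟩,
   ⟨10, 20, 26, 31⟩, ⟨4, 2, 49, 59⟩, ⟨10, 6, 48, 55⟩, ⟨6, 17, 18, 23⟩, ⟨2, 1, 12, 15⟩,
   ⟨6, 4, 8, 15⟩, ⟨4, 7, 59, 63⟩, ⟨8, 5, 20, 53⟩, ⟨6, 2, 52, 55⟩, ⟨12, 12, 12, 61⟩,
   ⟨4, 7, 16, 55⟩]

theorem fanDisjoint_check : checkCert 6 [7, 11, 49] (2 ^ 32) 2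
    (weightFun [10, 8, 6, 6, 5, 5])
    (expand fanDisjointPerms fanDisjointCuts) = true := by
  decide +kernel

/-- Symmetries of the shape with edges 012 013 014. -/
def starPerms : List (List ℕ) :=
  [[0, 1, 2, 3, 4], [0, 1, 2, 4, 3], [0, 1, 3, 2, 4], [0, 1, 3, 4, 2], [0, 1, 4, 2, 3],
   [0, 1, 4, 3, 2], [1, 0, 2, 3, 4], [1, 0, 2, 4, 3], [1, 0, 3, 2, 4], [1, 0, 3, 4, 2],
   [1, 0, 4, 2, 3], [1, 0, 4, 3, 2]]

/-- Cuts certifying the shape with edges 012 013 014. -/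
def starCuts : List Cut :=
  [⟨1, 1, 12, 15⟩, ⟨1, 5, 24, 31⟩, ⟨1, 0, 0, 7⟩, ⟨1, 4, 8, 15⟩]

theorem star_check : checkCert 5 [7, 11, 19] (2 ^ 16) 1
    (weightFun [3, 3, 2, 2, 2])
    (expand starPerms starCuts) = true := by
  decide +kernel

/-- Symmetries of the shape with edges 012 013 024. -/
def fanPathPerms : List (List ℕ) :=
  [[0, 1, 2, 3, 4], [0, 2, 1, 4, 3]]

/-- Cuts certifying the shape with edges 012 013 024. -/
def fanPathCuts : List Cut :=
  [⟨1, 26, 28, 31⟩, ⟨1, 6, 8, 15⟩, ⟨13, 2, 16, 23⟩, ⟨12, 1, 2, 7⟩, ⟨12, 3, 16, 23⟩,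
   ⟨1, 9, 12, 15⟩, ⟨28, 0, 0, 11⟩, ⟨8, 10, 20, 31⟩, ⟨3, 6, 26, 31⟩, ⟨9, 11, 26, 31⟩,
   ⟨7, 2, 12, 15⟩, ⟨4, 9, 24, 29⟩, ⟨3, 9, 12, 29⟩, ⟨1, 26, 26, 27⟩, ⟨15, 12, 24, 29⟩,
   ⟨7, 8, 16, 31⟩, ⟨3, 11, 12, 15⟩]

theorem fanPath_check : checkCert 5 [7, 11, 21] (2 ^ 16) 4
    (weightFun [4, 3, 3, 2, 2])
    (expand fanPathPerms fanPathCuts) = true := by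
  decide +kernel

/-- Symmetries of the shape with edges 012 013 023. -/
def trianglePerms : List (List ℕ) :=
  [[0, 1, 2, 3], [0, 1, 3, 2], [0, 2, 1, 3], [0, 2, 3, 1], [0, 3, 1, 2], [0, 3, 2, 1]]

/-- Cuts certifying the shape with edges 012 013 023. -/
def triangleCuts : List Cut :=
  [⟨1, 7, 11, 15⟩, ⟨2, 1, 1, 7⟩, ⟨2, 2, 12, 15⟩, ⟨2, 2, 4, 7⟩, ⟨4, 0, 0, 7⟩]

theorem triangle_check : checkCert 4 [7, 11, 13] (2 ^ 16) 6
    (weightFun [1, 1, 1, 1])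
    (expand trianglePerms triangleCuts) = true := by
  decide +kernel

/-- Symmetries of the shape with edges 012 034 156 278. -/
def spider0Perms : List (List ℕ) :=
  [[0, 1, 2, 3, 4, 5, 6, 7, 8], [0, 1, 2, 4, 3, 5, 6, 7, 8], [1, 0, 2, 5, 6, 3, 4, 7, 8],
   [1, 2, 0, 5, 6, 7, 8, 3, 4], [1, 0, 2, 6, 5, 3, 4, 7, 8], [1, 2, 0, 6, 5, 7, 8, 3, 4],
   [1, 0, 2, 5, 6, 4, 3, 7, 8], [2, 1, 0, 7, 8, 5, 6, 3, 4], [1, 2, 0, 5, 6, 7, 8, 4, 3],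
   [0, 2, 1, 3, 4, 7, 8, 5, 6], [2, 0, 1, 7, 8, 3, 4, 5, 6], [1, 0, 2, 6, 5, 4, 3, 7, 8],
   [2, 1, 0, 8, 7, 5, 6, 3, 4], [1, 2, 0, 6, 5, 7, 8, 4, 3], [0, 2, 1, 4, 3, 7, 8, 5, 6],
   [2, 0, 1, 8, 7, 3, 4, 5, 6], [0, 1, 2, 3, 4, 6, 5, 7, 8], [2, 1, 0, 7, 8, 6, 5, 3, 4],
   [2, 1, 0, 7, 8, 5, 6, 4, 3], [0, 2, 1, 3, 4, 7, 8, 6, 5], [2, 0, 1, 7, 8, 3, 4, 6, 5],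
   [2, 0, 1, 7, 8, 4, 3, 5, 6], [0, 1, 2, 4, 3, 6, 5, 7, 8], [2, 1, 0, 8, 7, 6, 5, 3, 4],
   [2, 1, 0, 8, 7, 5, 6, 4, 3], [0, 2, 1, 4, 3, 7, 8, 6, 5], [2, 0, 1, 8, 7, 3, 4, 6, 5],
   [2, 0, 1, 8, 7, 4, 3, 5, 6], [1, 2, 0, 5, 6, 8, 7, 3, 4], [2, 1, 0, 7, 8, 6, 5, 4, 3],
   [0, 2, 1, 3, 4, 8, 7, 5, 6], [1, 0, 2, 5, 6, 3, 4, 8, 7], [2, 0, 1, 7, 8, 4, 3, 6, 5],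
   [0, 1, 2, 3, 4, 5, 6, 8, 7], [1, 2, 0, 6, 5, 8, 7, 3, 4], [2, 1, 0, 8, 7, 6, 5, 4, 3],
   [0, 2, 1, 4, 3, 8, 7, 5, 6], [1, 0, 2, 6, 5, 3, 4, 8, 7], [2, 0, 1, 8, 7, 4, 3, 6, 5],
   [0, 1, 2, 4, 3, 5, 6, 8, 7], [1, 2, 0, 5, 6, 8, 7, 4, 3], [0, 2, 1, 3, 4, 8, 7, 6, 5],
   [1, 0, 2, 5, 6, 4, 3, 8, 7], [0, 1, 2, 3, 4, 6, 5, 8, 7], [1, 2, 0, 6, 5, 8, 7, 4, 3],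
   [0, 2, 1, 4, 3, 8, 7, 6, 5], [1, 0, 2, 6, 5, 4, 3, 8, 7], [0, 1, 2, 4, 3, 6, 5, 8, 7]]

/-- Cuts certifying the shape with edges 012 034 156 278. -/
def spider0Cuts : List Cut :=
  [⟨10, 8, 8, 106⟩, ⟨2, 1, 2, 7⟩, ⟨4, 11, 392, 399⟩, ⟨2, 7, 40, 127⟩, ⟨2, 25, 480, 511⟩,
   ⟨2, 10, 12, 15⟩, ⟨8, 10, 392, 399⟩, ⟨4, 14, 44, 110⟩, ⟨4, 41, 44, 47⟩, ⟨1, 25, 98, 123⟩,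
   ⟨4, 57, 418, 447⟩, ⟨4, 3, 384, 391⟩, ⟨8, 40, 40, 47⟩, ⟨2, 9, 488, 495⟩, ⟨2, 63, 423, 447⟩,
   ⟨1, 31, 103, 127⟩, ⟨4, 9, 106, 111⟩, ⟨4, 30, 60, 126⟩, ⟨8, 168, 168, 175⟩, ⟨4, 41, 426, 431⟩,
   ⟨6, 40, 396, 494⟩, ⟨8, 60, 184, 444⟩, ⟨6, 47, 428, 431⟩, ⟨4, 26, 444, 510⟩, ⟨4, 62, 186, 446⟩,
   ⟨8, 41, 41, 429⟩, ⟨8, 45, 169, 429⟩, ⟨2, 0, 0, 25⟩]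

theorem spider0_check : checkCert 9 [7, 25, 98, 388] (2 ^ 32) 8
    (weightFun [2, 2, 2, 1, 1, 1, 1, 1, 1])
    (expand spider0Perms spider0Cuts) = true := by
  decide +kernel

/-- Symmetries of the shape with edges 012 034 135 267. -/
def spider1Perms : List (List ℕ) :=
  [[0, 1, 2, 3, 4, 5, 6, 7], [0, 1, 2, 3, 4, 5, 7, 6], [1, 0, 2, 3, 5, 4, 6, 7],
   [1, 0, 2, 3, 5, 4, 7, 6]]

/-- Cuts certifying the shape with edges 012 034 135 267. -/
def spider1Cuts : List Cut :=
  [⟨306, 214, 229, 255⟩, ⟨406336, 16, 46, 63⟩, ⟨485928, 16, 230, 255⟩, ⟨493626, 13, 73, 205⟩,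
   ⟨519440, 19, 19, 27⟩, ⟨493626, 5, 12, 29⟩, ⟨53778, 4, 17, 221⟩, ⟨694436, 20, 24, 221⟩,
   ⟨79862, 75, 75, 79⟩, ⟨245088, 81, 98, 123⟩, ⟨357872, 209, 226, 251⟩, ⟨106115, 51, 51, 55⟩,
   ⟨257100, 17, 84, 215⟩, ⟨874438, 65, 96, 111⟩, ⟨406948, 18, 20, 23⟩, ⟨1005368, 21, 81, 213⟩,
   ⟨388082, 25, 112, 255⟩, ⟨233374, 83, 83, 91⟩, ⟨519440, 56, 56, 252⟩, ⟨321298, 0, 0, 7⟩,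
   ⟨622780, 26, 196, 223⟩, ⟨259720, 212, 228, 255⟩, ⟨656760, 193, 208, 217⟩,
   ⟨460456, 25, 209, 221⟩, ⟨1249802, 65, 106, 123⟩, ⟨545254, 9, 196, 239⟩, ⟨537598, 49, 49, 57⟩,
   ⟨2077760, 85, 85, 93⟩, ⟨1061282, 86, 116, 126⟩, ⟨441000, 87, 103, 127⟩, ⟨432150, 5, 20, 29⟩,
   ⟨227644, 16, 194, 223⟩, ⟨161568, 51, 240, 247⟩, ⟨24786, 20, 90, 223⟩, ⟨545254, 73, 76, 79⟩,
   ⟨113104, 5, 40, 47⟩, ⟨2370616, 82, 84, 87⟩, ⟨877006, 55, 112, 247⟩, ⟨4718, 91, 115, 123⟩,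
   ⟨815292, 69, 80, 95⟩, ⟨345884, 1, 2, 7⟩, ⟨1038880, 68, 80, 95⟩, ⟨161568, 48, 192, 255⟩,
   ⟨267683, 17, 34, 59⟩, ⟨406336, 22, 28, 62⟩, ⟨935540, 18, 220, 254⟩, ⟨279070, 113, 114, 123⟩,
   ⟨520052, 22, 82, 214⟩, ⟨233374, 65, 98, 111⟩, ⟨599302, 65, 72, 89⟩, ⟨61530, 82, 88, 122⟩,
   ⟨348842, 80, 98, 123⟩, ⟨1454980, 28, 88, 220⟩, ⟨79862, 65, 66, 71⟩, ⟨464689, 16, 32, 59⟩,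
   ⟨316272, 31, 59, 63⟩, ⟨293232, 52, 112, 244⟩, ⟨588428, 0, 0, 25⟩, ⟨417128, 195, 210, 219⟩,
   ⟨240314, 113, 116, 119⟩, ⟨609764, 211, 217, 251⟩, ⟨712076, 17, 18, 23⟩, ⟨519440, 68, 120, 127⟩,
   ⟨1792642, 86, 92, 126⟩, ⟨1824772, 64, 64, 71⟩, ⟨11988, 193, 193, 235⟩, ⟨545254, 7, 8, 47⟩,
   ⟨648594, 0, 0, 196⟩, ⟨1290331, 48, 48, 55⟩, ⟨71244, 193, 194, 251⟩, ⟨573918, 71, 123, 127⟩,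
   ⟨933204, 71, 72, 111⟩, ⟨519440, 195, 201, 235⟩, ⟨519440, 9, 200, 207⟩, ⟨11988, 25, 192, 221⟩,
   ⟨262716, 25, 117, 255⟩, ⟨103340, 1, 40, 59⟩, ⟨25814, 1, 8, 25⟩, ⟨467812, 8, 199, 223⟩,
   ⟨650500, 64, 64, 89⟩, ⟨519440, 1, 232, 239⟩, ⟨599302, 67, 73, 107⟩, ⟨865324, 3, 192, 199⟩,
   ⟨337662, 4, 88, 221⟩, ⟨647440, 4, 24, 31⟩, ⟨226208, 52, 52, 61⟩, ⟨552952, 49, 244, 253⟩,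
   ⟨589144, 23, 80, 215⟩, ⟨25814, 15, 204, 207⟩, ⟨223588, 69, 104, 111⟩, ⟨10440, 23, 25, 31⟩,
   ⟨488924, 80, 100, 127⟩, ⟨36744, 86, 90, 95⟩, ⟨589268, 57, 113, 253⟩, ⟨189484, 1, 224, 239⟩,
   ⟨519440, 210, 240, 250⟩, ⟨519440, 241, 241, 249⟩, ⟨547914, 1, 32, 47⟩, ⟨121928, 7, 64, 199⟩,
   ⟨51670, 18, 48, 58⟩, ⟨712076, 19, 208, 215⟩, ⟨25814, 12, 72, 204⟩]

theorem spider1_check : checkCert 8 [7, 25, 42, 196] (2 ^ 64) 519440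
    (weightFun [2, 2, 2, 2, 1, 1, 1, 1])
    (expand spider1Perms spider1Cuts) = true := by
  decide +kernel

/-- Symmetries of the shape with edges 012 034 135 256. -/
def spider2Perms : List (List ℕ) :=
  [[0, 1, 2, 3, 4, 5, 6], [2, 1, 0, 5, 6, 3, 4], [3, 1, 5, 0, 4, 2, 6], [5, 1, 3, 2, 6, 0, 4]]

/-- Cuts certifying the shape with edges 012 034 135 256. -/
def spider2Cuts : List Cut :=
  [⟨219, 25, 100, 125⟩, ⟨2517, 9, 12, 15⟩, ⟨414, 83, 90, 91⟩, ⟨3726, 0, 0, 25⟩, ⟨84, 13, 64, 111⟩,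
   ⟨560, 31, 59, 63⟩, ⟨657, 47, 125, 127⟩, ⟨3429, 1, 10, 31⟩, ⟨414, 82, 82, 91⟩,
   ⟨1404, 9, 68, 111⟩, ⟨46, 18, 111, 127⟩, ⟨1242, 22, 50, 118⟩, ⟨2900, 17, 48, 119⟩,
   ⟨465, 1, 32, 47⟩, ⟨2052, 20, 25, 31⟩, ⟨2484, 85, 89, 95⟩, ⟨3648, 11, 64, 111⟩, ⟨219, 2, 9, 47⟩,
   ⟨2484, 80, 80, 87⟩, ⟨496, 18, 21, 23⟩, ⟨332, 95, 119, 127⟩, ⟨2478, 16, 100, 125⟩,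
   ⟨1492, 17, 20, 23⟩, ⟨1656, 1, 8, 47⟩, ⟨225, 5, 40, 125⟩, ⟨2265, 2, 2, 7⟩, ⟨78, 30, 52, 62⟩,
   ⟨432, 5, 12, 29⟩, ⟨93, 3, 41, 43⟩, ⟨620, 3, 18, 27⟩, ⟨1170, 45, 52, 61⟩, ⟨311, 19, 26, 27⟩,
   ⟨3648, 28, 54, 62⟩, ⟨826, 3, 98, 103⟩, ⟨828, 82, 92, 95⟩, ⟨996, 20, 56, 126⟩,
   ⟨2484, 21, 81, 117⟩, ⟨1656, 17, 98, 127⟩, ⟨6, 20, 48, 116⟩, ⟨1386, 13, 41, 109⟩,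
   ⟨828, 81, 112, 123⟩, ⟨2265, 1, 42, 59⟩, ⟨828, 18, 81, 119⟩, ⟨801, 5, 40, 47⟩,
   ⟨1736, 18, 28, 126⟩]

theorem spider2_check : checkCert 7 [7, 25, 42, 100] (2 ^ 32) 1242
    (weightFun [2, 2, 2, 2, 1, 2, 1])
    (expand spider2Perms spider2Cuts) = true := by
  decide +kernel

/-- Symmetries of the shape with edges 012 034 135 245. -/
def spider3Perms : List (List ℕ) :=
  [[0, 1, 2, 3, 4, 5], [0, 2, 1, 4, 3, 5], [0, 3, 4, 1, 2, 5], [0, 4, 3, 2, 1, 5],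
   [1, 0, 2, 3, 5, 4], [1, 2, 0, 5, 3, 4], [1, 3, 5, 0, 2, 4], [1, 5, 3, 2, 0, 4],
   [2, 0, 1, 4, 5, 3], [2, 1, 0, 5, 4, 3], [2, 4, 5, 0, 1, 3], [2, 5, 4, 1, 0, 3],
   [3, 0, 4, 1, 5, 2], [3, 1, 5, 0, 4, 2], [3, 4, 0, 5, 1, 2], [3, 5, 1, 4, 0, 2],
   [4, 0, 3, 2, 5, 1], [4, 2, 5, 0, 3, 1], [4, 3, 0, 5, 2, 1], [4, 5, 2, 3, 0, 1],
   [5, 1, 3, 2, 4, 0], [5, 2, 4, 1, 3, 0], [5, 3, 1, 4, 2, 0], [5, 4, 2, 3, 1, 0]]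

/-- Cuts certifying the shape with edges 012 034 135 245. -/
def spider3Cuts : List Cut :=
  [⟨20, 13, 37, 61⟩, ⟨34, 1, 32, 47⟩, ⟨12, 3, 9, 43⟩, ⟨20, 0, 0, 7⟩, ⟨2, 1, 10, 59⟩,
   ⟨7, 13, 14, 15⟩, ⟨54, 3, 18, 27⟩, ⟨10, 7, 25, 31⟩, ⟨7, 11, 21, 31⟩, ⟨10, 1, 62, 63⟩]

theorem spider3_check : checkCert 6 [7, 25, 42, 52] (2 ^ 32) 80
    (weightFun [1, 1, 1, 1, 1, 1])
    (expand spider3Perms spider3Cuts) = true := by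
  decide +kernel

/-- Symmetries of the shape with edges 012 013 234. -/
def pairTailPerms : List (List ℕ) :=
  [[0, 1, 2, 3, 4], [0, 1, 3, 2, 4], [1, 0, 2, 3, 4], [1, 0, 3, 2, 4]]

/-- Cuts certifying the shape with edges 012 013 234. -/
def pairTailCuts : List Cut :=
  [⟨1, 4, 4, 7⟩, ⟨5, 1, 28, 31⟩, ⟨6, 17, 20, 23⟩, ⟨1, 4, 11, 15⟩, ⟨2, 16, 16, 28⟩, ⟨5, 1, 12, 15⟩,
   ⟨1, 3, 16, 31⟩, ⟨9, 0, 0, 7⟩, ⟨3, 7, 16, 31⟩, ⟨2, 5, 9, 29⟩, ⟨1, 13, 13, 29⟩, ⟨4, 4, 8, 28⟩,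
   ⟨1, 16, 16, 23⟩, ⟨1, 21, 25, 29⟩]

theorem pairTail_check : checkCert 5 [7, 11, 28] (2 ^ 16) 4
    (weightFun [2, 2, 2, 2, 1])
    (expand pairTailPerms pairTailCuts) = true := by
  decide +kernel

/-- Symmetries of the shape with edges 012 013 245 345. -/
def twin2Perms : List (List ℕ) :=
  [[0, 1, 2, 3, 4, 5], [0, 1, 2, 3, 5, 4], [0, 1, 3, 2, 4, 5], [0, 1, 3, 2, 5, 4],
   [1, 0, 2, 3, 4, 5], [1, 0, 2, 3, 5, 4], [1, 0, 3, 2, 4, 5], [1, 0, 3, 2, 5, 4],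
   [4, 5, 2, 3, 0, 1], [4, 5, 2, 3, 1, 0], [4, 5, 3, 2, 0, 1], [4, 5, 3, 2, 1, 0],
   [5, 4, 2, 3, 0, 1], [5, 4, 2, 3, 1, 0], [5, 4, 3, 2, 0, 1], [5, 4, 3, 2, 1, 0]]

/-- Cuts certifying the shape with edges 012 013 245 345. -/
def twin2Cuts : List Cut :=
  [⟨1, 23, 27, 31⟩, ⟨4, 1, 4, 7⟩, ⟨4, 7, 28, 63⟩, ⟨10, 1, 1, 53⟩, ⟨4, 5, 12, 15⟩, ⟨8, 5, 17, 53⟩,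
   ⟨2, 3, 48, 59⟩, ⟨8, 5, 25, 61⟩, ⟨2, 4, 8, 60⟩, ⟨3, 7, 52, 55⟩, ⟨2, 1, 60, 63⟩, ⟨6, 0, 0, 7⟩]

theorem twin2_check : checkCert 6 [7, 11, 52, 56] (2 ^ 32) 16
    (weightFun [1, 1, 1, 1, 1, 1])
    (expand twin2Perms twin2Cuts) = true := by
  decide +kernel

/-- Symmetries of the shape with edges 012 013 245 356. -/
def twin1Perms : List (List ℕ) :=
  [[0, 1, 2, 3, 4, 5, 6], [0, 1, 3, 2, 6, 5, 4], [1, 0, 2, 3, 4, 5, 6], [1, 0, 3, 2, 6, 5, 4]]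

/-- Cuts certifying the shape with edges 012 013 245 356. -/
def twin1Cuts : List Cut :=
  [⟨38, 19, 80, 123⟩, ⟨44, 17, 92, 127⟩, ⟨38, 5, 65, 125⟩, ⟨38, 3, 16, 55⟩, ⟨56, 13, 25, 61⟩,
   ⟨4, 3, 112, 127⟩, ⟨126, 0, 0, 7⟩, ⟨38, 17, 20, 23⟩, ⟨40, 84, 88, 95⟩, ⟨44, 7, 107, 111⟩,
   ⟨84, 49, 56, 59⟩, ⟨92, 21, 24, 31⟩, ⟨38, 7, 16, 55⟩, ⟨15, 21, 73, 125⟩, ⟨8, 4, 96, 124⟩,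
   ⟨4, 4, 89, 127⟩, ⟨4, 5, 104, 111⟩, ⟨26, 7, 52, 55⟩, ⟨42, 37, 44, 47⟩, ⟨42, 27, 48, 123⟩,
   ⟨56, 53, 85, 125⟩, ⟨34, 16, 75, 127⟩, ⟨84, 5, 33, 53⟩, ⟨84, 32, 32, 39⟩, ⟨42, 13, 37, 109⟩,
   ⟨88, 7, 64, 111⟩, ⟨46, 17, 120, 123⟩, ⟨86, 17, 28, 31⟩, ⟨4, 27, 88, 123⟩, ⟨70, 1, 4, 7⟩,
   ⟨34, 24, 48, 120⟩, ⟨22, 20, 72, 124⟩, ⟨56, 1, 1, 53⟩, ⟨12, 16, 104, 124⟩, ⟨56, 5, 9, 125⟩,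
   ⟨42, 4, 4, 108⟩, ⟨18, 81, 92, 95⟩, ⟨66, 25, 81, 121⟩, ⟨26, 31, 79, 127⟩, ⟨38, 83, 112, 123⟩,
   ⟨44, 4, 72, 111⟩, ⟨42, 1, 12, 15⟩, ⟨42, 19, 48, 55⟩, ⟨42, 36, 40, 47⟩, ⟨7, 63, 111, 127⟩,
   ⟨46, 80, 80, 87⟩, ⟨150, 29, 29, 61⟩, ⟨3, 85, 89, 125⟩]

theorem twin1_check : checkCert 7 [7, 11, 52, 104] (2 ^ 32) 42
    (weightFun [2, 2, 2, 2, 1, 2, 1])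
    (expand twin1Perms twin1Cuts) = true := by
  decide +kernel

/-- Symmetries of the shape with edges 012 013 245 367. -/
def twin0Perms : List (List ℕ) :=
  [[0, 1, 2, 3, 4, 5, 6, 7], [0, 1, 2, 3, 4, 5, 7, 6], [0, 1, 2, 3, 5, 4, 6, 7],
   [0, 1, 2, 3, 5, 4, 7, 6], [0, 1, 3, 2, 6, 7, 4, 5], [0, 1, 3, 2, 6, 7, 5, 4],
   [0, 1, 3, 2, 7, 6, 4, 5], [0, 1, 3, 2, 7, 6, 5, 4], [1, 0, 2, 3, 4, 5, 6, 7],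
   [1, 0, 2, 3, 4, 5, 7, 6], [1, 0, 2, 3, 5, 4, 6, 7], [1, 0, 2, 3, 5, 4, 7, 6],
   [1, 0, 3, 2, 6, 7, 4, 5], [1, 0, 3, 2, 6, 7, 5, 4], [1, 0, 3, 2, 7, 6, 4, 5],
   [1, 0, 3, 2, 7, 6, 5, 4]]

/-- Cuts certifying the shape with edges 012 013 245 367. -/
def twin0Cuts : List Cut :=
  [⟨4, 1, 12, 15⟩, ⟨16, 20, 25, 31⟩, ⟨12, 13, 25, 61⟩, ⟨8, 5, 9, 253⟩, ⟨4, 3, 240, 255⟩,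
   ⟨8, 113, 120, 123⟩, ⟨12, 29, 85, 221⟩, ⟨20, 81, 92, 95⟩, ⟨2, 24, 80, 216⟩, ⟨4, 4, 201, 207⟩,
   ⟨8, 28, 84, 220⟩, ⟨16, 7, 192, 207⟩, ⟨3, 0, 0, 52⟩, ⟨2, 63, 207, 255⟩, ⟨9, 0, 0, 7⟩,
   ⟨12, 17, 24, 27⟩, ⟨12, 5, 17, 53⟩, ⟨8, 19, 208, 219⟩, ⟨8, 57, 113, 249⟩, ⟨8, 17, 20, 23⟩,
   ⟨16, 59, 112, 251⟩, ⟨16, 17, 216, 219⟩, ⟨36, 21, 21, 221⟩, ⟨2, 55, 252, 255⟩, ⟨12, 81, 84, 87⟩,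
   ⟨34, 16, 16, 23⟩, ⟨5, 7, 52, 55⟩, ⟨30, 23, 80, 223⟩, ⟨5, 87, 91, 95⟩, ⟨12, 1, 4, 7⟩,
   ⟨4, 23, 27, 31⟩, ⟨6, 16, 200, 252⟩, ⟨8, 49, 201, 253⟩, ⟨2, 84, 88, 95⟩, ⟨10, 24, 84, 223⟩,
   ⟨8, 49, 56, 59⟩]

theorem twin0_check : checkCert 8 [7, 11, 52, 200] (2 ^ 32) 16
    (weightFun [2, 2, 2, 2, 1, 1, 1, 1])
    (expand twin0Perms twin0Cuts) = true := by
  decide +kernel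

/-- Symmetries of the shape with edges 012 013 245 456. -/
def dumbbell0Perms : List (List ℕ) :=
  [[0, 1, 2, 3, 4, 5, 6], [0, 1, 2, 3, 5, 4, 6], [1, 0, 2, 3, 4, 5, 6], [1, 0, 2, 3, 5, 4, 6],
   [4, 5, 2, 6, 0, 1, 3], [4, 5, 2, 6, 1, 0, 3], [5, 4, 2, 6, 0, 1, 3], [5, 4, 2, 6, 1, 0, 3]]

/-- Cuts certifying the shape with edges 012 013 245 456. -/
def dumbbell0Cuts : List Cut :=
  [⟨8, 21, 24, 31⟩, ⟨8, 5, 17, 53⟩, ⟨1, 7, 52, 55⟩, ⟨2, 9, 9, 121⟩, ⟨1, 3, 112, 123⟩,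
   ⟨1, 3, 48, 55⟩, ⟨7, 25, 77, 125⟩, ⟨1, 24, 76, 124⟩, ⟨1, 15, 123, 127⟩, ⟨2, 1, 4, 7⟩,
   ⟨3, 28, 72, 124⟩, ⟨2, 1, 8, 11⟩, ⟨1, 12, 24, 60⟩, ⟨5, 0, 0, 11⟩, ⟨2, 19, 67, 115⟩,
   ⟨2, 8, 117, 127⟩, ⟨1, 4, 89, 127⟩, ⟨3, 8, 113, 123⟩, ⟨10, 9, 9, 61⟩, ⟨7, 1, 112, 119⟩,
   ⟨3, 1, 12, 15⟩, ⟨1, 3, 112, 119⟩, ⟨1, 8, 8, 60⟩, ⟨5, 13, 73, 125⟩, ⟨1, 25, 73, 121⟩,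
   ⟨2, 23, 27, 31⟩]

theorem dumbbell0_check : checkCert 7 [7, 11, 52, 112] (2 ^ 32) 2
    (weightFun [3, 3, 4, 2, 3, 3, 2])
    (expand dumbbell0Perms dumbbell0Cuts) = true := by
  decide +kernel

/-- Symmetries of the shape with edges 012 013 245 567 678. -/
def dumbbell1Perms : List (List ℕ) :=
  [[0, 1, 2, 3, 4, 5, 6, 7, 8], [1, 0, 2, 3, 4, 5, 6, 7, 8], [0, 1, 2, 3, 4, 5, 7, 6, 8],
   [6, 7, 5, 8, 4, 2, 0, 1, 3], [1, 0, 2, 3, 4, 5, 7, 6, 8], [7, 6, 5, 8, 4, 2, 0, 1, 3],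
   [6, 7, 5, 8, 4, 2, 1, 0, 3], [7, 6, 5, 8, 4, 2, 1, 0, 3]]

/-- Cuts certifying the shape with edges 012 013 245 567 678. -/
def dumbbell1Cuts : List Cut :=
  [⟨5237420950, 71, 319, 511⟩, ⟨1947744108, 201, 204, 207⟩, ⟨570564466, 24, 113, 251⟩,
   ⟨9868838798, 65, 65, 117⟩, ⟨1298496072, 25, 205, 253⟩, ⟨6432901776, 29, 201, 253⟩,
   ⟨35071056, 24, 33, 63⟩, ⟨9573526378, 53, 337, 501⟩, ⟨4237528596, 65, 92, 127⟩,
   ⟨1150493798, 1, 248, 255⟩, ⟨1035585318, 8, 496, 511⟩, ⟨57468132, 47, 263, 495⟩,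
   ⟨110128888, 28, 273, 479⟩, ⟨2764281620, 29, 29, 477⟩, ⟨1442706120, 15, 235, 239⟩,
   ⟨2060516592, 233, 265, 489⟩, ⟨6951320734, 5, 449, 501⟩, ⟨192980064, 33, 257, 481⟩,
   ⟨4768688316, 99, 259, 483⟩, ⟨14447830272, 101, 104, 111⟩, ⟨5746047068, 76, 268, 460⟩,
   ⟨3263813782, 51, 83, 243⟩, ⟨891652740, 19, 272, 475⟩, ⟨3147880404, 25, 329, 509⟩,
   ⟨1871188904, 79, 296, 495⟩, ⟨2376427818, 335, 347, 383⟩, ⟨3004404100, 1, 240, 247⟩,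
   ⟨937682942, 31, 91, 479⟩, ⟨7142363128, 65, 76, 79⟩, ⟨272594402, 75, 271, 463⟩,
   ⟨4384697316, 5, 17, 53⟩, ⟨7237588136, 13, 265, 509⟩, ⟨10771828190, 8, 52, 63⟩,
   ⟨1499456190, 15, 455, 463⟩, ⟨5195640314, 27, 120, 251⟩, ⟨9467039076, 93, 285, 477⟩,
   ⟨5406599700, 51, 275, 499⟩, ⟨1451598048, 4, 200, 239⟩, ⟨382138594, 20, 464, 471⟩,
   ⟨6876847598, 57, 281, 505⟩, ⟨308739334, 5, 448, 455⟩, ⟨2220997426, 1, 460, 463⟩,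
   ⟨7223915136, 16, 16, 23⟩, ⟨3033946182, 72, 312, 508⟩, ⟨18059787840, 37, 69, 229⟩,
   ⟨9620529930, 1, 224, 235⟩, ⟨2956472582, 56, 88, 248⟩, ⟨2521805676, 15, 103, 239⟩,
   ⟨812733528, 72, 264, 456⟩, ⟨2814707258, 3, 464, 503⟩, ⟨423014886, 17, 65, 245⟩,
   ⟨8280267416, 25, 457, 509⟩, ⟨2896130676, 103, 267, 495⟩, ⟨902989392, 16, 195, 247⟩,
   ⟨2354086554, 33, 36, 39⟩, ⟨1644733066, 251, 475, 507⟩, ⟨11844472588, 109, 269, 493⟩,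
   ⟨8818672936, 73, 297, 489⟩, ⟨9062252554, 13, 41, 61⟩, ⟨9932883312, 0, 0, 52⟩,
   ⟨53578644, 8, 68, 239⟩, ⟨4768688316, 35, 67, 227⟩, ⟨9415131498, 9, 9, 61⟩,
   ⟨749257070, 95, 271, 511⟩, ⟨9528349328, 40, 72, 232⟩, ⟨548107770, 9, 228, 239⟩,
   ⟨2239167732, 88, 280, 472⟩, ⟨4046154696, 33, 44, 47⟩, ⟨1726841290, 8, 256, 459⟩,
   ⟨967033906, 52, 81, 247⟩, ⟨6716432424, 17, 193, 245⟩, ⟨7188844080, 89, 105, 125⟩,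
   ⟨1174743869, 55, 244, 247⟩, ⟨300593022, 88, 312, 504⟩, ⟨1412657948, 297, 300, 303⟩,
   ⟨256448014, 104, 271, 495⟩, ⟨3178768620, 120, 280, 504⟩, ⟨7137007210, 12, 12, 236⟩,
   ⟨4852404134, 252, 488, 508⟩, ⟨1156730748, 67, 259, 451⟩, ⟨14366278264, 45, 77, 237⟩,
   ⟨8057255354, 313, 345, 505⟩, ⟨9412032514, 49, 81, 241⟩, ⟨1842123716, 8, 453, 463⟩,
   ⟨7767424090, 3, 48, 55⟩, ⟨3196465928, 24, 336, 475⟩, ⟨253741356, 199, 203, 207⟩,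
   ⟨1257871014, 36, 41, 47⟩, ⟨19068387724, 329, 329, 381⟩, ⟨1168571966, 17, 464, 475⟩,
   ⟨1297417382, 89, 281, 473⟩, ⟨4383108980, 53, 225, 245⟩, ⟨749887416, 27, 200, 255⟩,
   ⟨1180407756, 92, 284, 476⟩, ⟨40876292, 12, 40, 60⟩, ⟨4491778738, 81, 124, 127⟩,
   ⟨12453425616, 85, 88, 95⟩, ⟨3334539204, 28, 456, 508⟩, ⟨523705550, 231, 459, 495⟩,
   ⟨1783320628, 20, 473, 479⟩, ⟨2970820951, 7, 224, 231⟩, ⟨535493410, 24, 341, 479⟩,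
   ⟨11253468916, 61, 73, 253⟩, ⟨1090151892, 37, 325, 485⟩, ⟨46217936, 79, 311, 511⟩,
   ⟨1423840190, 49, 56, 59⟩, ⟨7005760556, 17, 24, 27⟩, ⟨7235033506, 104, 264, 488⟩,
   ⟨11715693874, 60, 72, 252⟩, ⟨6084338502, 5, 232, 239⟩, ⟨259409682, 215, 219, 223⟩,
   ⟨1331530772, 63, 500, 511⟩, ⟨2603357684, 333, 361, 381⟩, ⟨4910453640, 83, 307, 499⟩,
   ⟨11047224872, 1, 4, 7⟩, ⟨301421522, 11, 448, 459⟩, ⟨2598255388, 9, 452, 463⟩,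
   ⟨230889024, 91, 104, 127⟩, ⟨3960101354, 21, 209, 245⟩, ⟨5192521478, 87, 263, 503⟩,
   ⟨9903220168, 281, 281, 317⟩, ⟨2843602364, 25, 276, 479⟩, ⟨2938936696, 237, 269, 493⟩,
   ⟨6298836212, 25, 233, 253⟩, ⟨1209761968, 19, 464, 471⟩, ⟨1055080836, 41, 73, 233⟩,
   ⟨2622060250, 236, 460, 492⟩, ⟨4045146516, 21, 472, 479⟩, ⟨731610618, 47, 331, 495⟩,
   ⟨3779247044, 17, 28, 31⟩, ⟨201340494, 127, 271, 511⟩, ⟨12722208320, 9, 9, 233⟩,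
   ⟨1309832724, 24, 204, 252⟩, ⟨11380395424, 73, 265, 457⟩, ⟨253741356, 3, 32, 235⟩,
   ⟨7215322150, 11, 112, 255⟩, ⟨792276604, 4, 4, 452⟩, ⟨1266647084, 40, 324, 495⟩,
   ⟨16933174, 63, 235, 255⟩, ⟨4174496174, 269, 457, 509⟩, ⟨11377916826, 5, 33, 53⟩,
   ⟨3657989202, 1, 12, 15⟩, ⟨509668556, 44, 268, 492⟩, ⟨902989392, 264, 264, 316⟩,
   ⟨2738631320, 269, 297, 317⟩, ⟨5122500428, 19, 240, 251⟩]

theorem dumbbell1_check : checkCert 9 [7, 11, 52, 224, 448] (2 ^ 64) 1805978784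
    (weightFun [5, 5, 7, 3, 4, 7, 5, 5, 3])
    (expand dumbbell1Perms dumbbell1Cuts) = true := by
  decide +kernel

/-- A potential on the masks of five consecutive points of a chain of edges. -/
def potential : List ℤ :=
  [7536284094120072929751003404, 0, 4248640165423976850873197560780,
   16407488015682604776294087965538, 7536284094120072929751003404,
   -6795547995352777938033335523504, 1578173263926426920636020068342,
   -12776601960858867173039053241408, -4248640165423976850873197560780,
   -8108654322018436018463060363436, -52216934955298819854147113216,
   1448264002303236109263164399816, -1622853914787605667560416178154,
   -9592357082444650875518471625296, 37144366767058673994645106408,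
   -8183770833935537488404309150202, 15072568188240145859502006808, 7536284094120072929751003404,
   7972464154620733015073432391552, 15595600884316726344297766803022,
   6674430396143315080503209558428, 7536284094120072929751003404, 9728547249842353878908099597180,
   2781821049255408578040639378958, -16407488015682604776294087965538,
   -15595600884316726344297766803022, -1463336570491476255122666406624,
   -7536284094120072929751003404, 12776601960858867173039053241408,
   -2645630881857705574651011407074, 8213378916608476089469203253206,
   -7536284094120072929751003404]

/-- The mask of the positions `q` in the mask `Y`. -/
def subMask (q : List ℕ) (Y : ℕ) : ℕ :=
  q.foldr (fun t r => Nat.bit (Y.testBit t) r) 0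

/-- The total potential of the family `F` along the points `l`. -/
def totalPotential (F : Finset (Finset ℕ)) (l : List ℕ) : ℤ :=
  ∑ A ∈ F, potential.getD (mask l A) 0

/-- A weight functional plus signed potentials of lists of positions. -/
def chainFun (w : List ℕ) (q : List (ℤ × List ℕ)) (Y : ℕ) : ℤ :=
  weightFun w Y + (q.map fun t => t.1 * potential.getD (subMask t.2 Y) 0).sum

theorem subMask_mask (l q : List ℕ) (hq : ∀ t ∈ q, t < l.length) (A : Finset ℕ) :
    subMask q (mask l A) = mask (q.map fun t => l.getD t 0) A := by
  induction q with
  | nil => rfl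
  | cons t q ih =>
    rw [List.forall_mem_cons] at hq
    rw [List.map_cons, mask_cons, ← ih hq.2, subMask, List.foldr_cons, testBit_mask,
      List.getD_eq_getElem?_getD, List.getElem?_eq_getElem hq.1]
    rfl

theorem sum_chainFun (F : Finset (Finset ℕ)) (w l : List ℕ) (q : List (ℤ × List ℕ))
    (hq : ∀ p ∈ q, ∀ t ∈ p.2, t < l.length) :
    ∑ A ∈ F, chainFun w q (mask l A) = ∑ A ∈ F, weightFun w (mask l A)
      + (q.map fun p => p.1 * totalPotential F (p.2.map fun t => l.getD t 0)).sum := by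
  simp only [chainFun, Finset.sum_add_distrib]
  congr 1
  induction q with
  | nil => simp
  | cons p q ih =>
    rw [List.forall_mem_cons] at hq
    simp only [List.map_cons, List.sum_cons, Finset.sum_add_distrib, ih hq.2, totalPotential,
      Finset.mul_sum, subMask_mask l _ hq.1]

theorem Counterexample.sum_potential_nonneg {F : Finset (Finset ℕ)} (hF : Counterexample F)
    {l : List ℕ} (hl : l.Nodup) {E : List ℕ} (hE : ∀ e ∈ E, maskSet l e ∈ F) {B d : ℕ}
    {w : List ℕ} (hw : w.length = l.length) {q : List (ℤ × List ℕ)}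
    (hq : ∀ p ∈ q, ∀ t ∈ p.2, t < l.length) {C : List Cut}
    (h : checkCert l.length E B d (chainFun w q) C = true) :
    (w.sum : ℤ) ≤ (q.map fun p => p.1 * totalPotential F (p.2.map fun t => l.getD t 0)).sum := by
  have h1 := sum_mask_nonneg_of_checkCert hF.uc hl hE h
  have h2 := hF.sum_weightFun_le w l hw
  rw [sum_chainFun F w l q hq] at h1
  linarith

/-- Cuts certifying the chain inequality with edges 012 013 245 567. -/
def chainStartCuts : List Cut :=
  [⟨749478090024675093473584154386, 131, 192, 235⟩,
   ⟨18007884838294650717052864414840, 144, 144, 151⟩,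
   ⟨853455793952390750137927663988, 71, 99, 119⟩, ⟨1775481527565825960745355659242, 56, 72, 252⟩,
   ⟨15261677507292491300629920452916, 96, 96, 107⟩,
   ⟨16439549163521611050716811968158, 33, 40, 43⟩,
   ⟨16245577444464420507461377259918, 228, 233, 239⟩,
   ⟨3219838538927858999185885258470, 12, 21, 63⟩,
   ⟨28393814851998778860280088108820, 132, 137, 143⟩,
   ⟨32112155048128942912412214010073, 160, 160, 167⟩,
   ⟨3156566354127275197174417171382, 59, 91, 251⟩, ⟨5140575145433011146359896763750, 16, 35, 55⟩,
   ⟨748471168409330061162315881946, 65, 92, 127⟩, ⟨1853537060959648405163989993924, 65, 72, 75⟩,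
   ⟨1682087252845348780857139466044, 19, 192, 247⟩, ⟨4111433861969503795665847835122, 91, 92, 95⟩,
   ⟨25086146539860139801623412577904, 139, 176, 191⟩,
   ⟨1876874514072772584826658130448, 109, 121, 125⟩,
   ⟨25494652930263731774238629000952, 209, 220, 223⟩,
   ⟨1444764001984880410458891000142, 21, 192, 247⟩,
   ⟨26627610765152053127194956290592, 20, 192, 244⟩,
   ⟨14531406439991108248101452483940, 21, 193, 245⟩,
   ⟨3498638110524874680718704503480, 105, 108, 111⟩,
   ⟨13070427258413902433528097089904, 141, 169, 189⟩,
   ⟨24152460397714731978720673256810, 227, 240, 247⟩,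
   ⟨11958818477288474814140290605328, 128, 128, 135⟩,
   ⟨35421535579891094231688731944400, 129, 136, 139⟩,
   ⟨24478577916437005225620967994814, 81, 84, 87⟩,
   ⟨27884705172756224379332344882124, 149, 152, 159⟩, ⟨218326032048733418852564638, 80, 149, 247⟩,
   ⟨101514887369245446918666976829774, 1, 1, 53⟩,
   ⟨14494692316460527235536771834394, 100, 104, 111⟩,
   ⟨4724977000185462320795071969830, 4, 192, 231⟩,
   ⟨21349938035419789942938136960224, 67, 112, 119⟩,
   ⟨66415504162893536495708869080076, 137, 137, 189⟩,
   ⟨14094043529904866549655298579452, 153, 169, 189⟩,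
   ⟨27770610552054135497926618055772, 113, 120, 123⟩,
   ⟨20767828141863070300541519633768, 81, 97, 117⟩,
   ⟨3775896450047741496860946889956, 139, 184, 191⟩,
   ⟨3863328308093839792031871227174, 9, 68, 239⟩, ⟨1880709145652495958107192039904, 65, 133, 245⟩,
   ⟨8772865794774027351801999855586, 4, 8, 15⟩, ⟨3368394865185734703254337999860, 16, 224, 244⟩,
   ⟨5219211526482868316142558759868, 131, 160, 183⟩,
   ⟨1816419799669352875402138176408, 57, 137, 253⟩, ⟨997404938839922972883633881562, 41, 73, 233⟩,
   ⟨4339583794271906919094544367122, 103, 107, 111⟩,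
   ⟨2487021141186397444941290721412, 80, 99, 119⟩,
   ⟨13941796405104645083343467210804, 17, 65, 245⟩, ⟨8796516319181160392031558397322, 1, 8, 11⟩,
   ⟨13102847597287867339416719887228, 27, 32, 63⟩, ⟨12913923438453366462387505020420, 39, 43, 47⟩,
   ⟨15896648439811807945365514629676, 7, 16, 55⟩,
   ⟨20426961862372279740348767244138, 161, 172, 175⟩,
   ⟨1262927044438651814247601312294, 131, 144, 183⟩,
   ⟨5902298213899793033533076258254, 129, 132, 135⟩,
   ⟨17547623125094766242514519240953, 192, 192, 203⟩,
   ⟨14984268294804395791940540303646, 53, 225, 245⟩,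
   ⟨5358012430776396276909113935104, 135, 139, 143⟩,
   ⟨580435678586685818566992257568, 3, 160, 231⟩,
   ⟨28426870085322196820842693019214, 225, 252, 255⟩,
   ⟨18039990294125307198480173985664, 208, 208, 219⟩,
   ⟨2329421728136441841689551707338, 16, 203, 255⟩,
   ⟨5611827368408345292883370467382, 75, 88, 127⟩, ⟨3985256881514059005353286431606, 32, 32, 43⟩,
   ⟨10956071124944467602530460348964, 141, 153, 189⟩,
   ⟨2543279706132903235910321856530, 225, 240, 247⟩,
   ⟨3911415941801930947019105585048, 49, 145, 241⟩, ⟨29123583546305252737485917785976, 4, 32, 52⟩,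
   ⟨23310994695943527362127863665976, 140, 168, 188⟩,
   ⟨5076158579099715536084210462738, 27, 216, 251⟩,
   ⟨4189707311666621486410275316680, 133, 145, 181⟩,
   ⟨14975593777358618143236188577582, 71, 151, 247⟩,
   ⟨7926818187486566296438547882178, 61, 249, 253⟩,
   ⟨27888138038453066248550473876556, 73, 116, 127⟩,
   ⟨22280945185306003939195097594086, 133, 161, 181⟩,
   ⟨59313142974482608575534661513526, 128, 128, 180⟩,
   ⟨12875953655685290885047998941170, 27, 48, 251⟩,
   ⟨13979935680463773493189417662676, 56, 56, 59⟩, ⟨5243168581556801607542959957680, 4, 41, 63⟩,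
   ⟨11431528548967635227748921643100, 143, 183, 191⟩,
   ⟨5914200555851987856971820813726, 231, 235, 239⟩,
   ⟨12281637996389288709616099182002, 85, 193, 245⟩,
   ⟨31699808493321839501512885261194, 193, 196, 199⟩,
   ⟨977856018516244277611960532984, 24, 232, 252⟩,
   ⟨40521024631360465773658614685822, 77, 89, 125⟩,
   ⟨76295856852173550042117433368328, 64, 64, 116⟩, ⟨15618175176267428743670877361049, 7, 52, 55⟩,
   ⟨14643017924270260580924753444862, 69, 97, 117⟩,
   ⟨4190088534217020083899840706352, 68, 132, 228⟩,
   ⟨39575037842787737978617262509174, 65, 116, 119⟩,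
   ⟨22946843011455006602597966750340, 37, 40, 47⟩,
   ⟨16114585244284445095981811068138, 145, 152, 155⟩,
   ⟨17414997709648641801666309142904, 229, 232, 239⟩,
   ⟨37906533106209622100317398614592, 79, 80, 127⟩, ⟨1568281926811792425937234639706, 24, 40, 60⟩,
   ⟨37412764504130778596943220140357, 0, 0, 7⟩, ⟨912636256012692038970546936256, 79, 99, 127⟩,
   ⟨14017989244739097992168573483712, 88, 104, 124⟩,
   ⟨15510163620560280564923797085306, 231, 244, 247⟩,
   ⟨1665016724167750837796869598094, 67, 192, 235⟩, ⟨43237590270346256832644676474143, 0, 0, 52⟩,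
   ⟨1277857928622049912354221059944, 85, 113, 117⟩,
   ⟨4443465981886106753207662870296, 68, 80, 116⟩, ⟨38972342033427287037335127636958, 9, 52, 63⟩,
   ⟨8467864580838358099552212023202, 16, 195, 247⟩,
   ⟨40759291838702912446251230585144, 5, 224, 231⟩,
   ⟨24084686176697093135110515566586, 97, 108, 111⟩,
   ⟨10957236366305630164703580273174, 136, 144, 191⟩,
   ⟨3462375411871127404344869882270, 60, 136, 252⟩,
   ⟨28160697696285586104778764469218, 197, 200, 207⟩,
   ⟨2291596232058545712905168808106, 67, 131, 227⟩,
   ⟨3185951519824559724528995980008, 235, 240, 255⟩, ⟨2773229950345622377055519716800, 7, 11, 15⟩,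
   ⟨10736804285570708433554583300233, 167, 171, 175⟩,
   ⟨23923998466554598706342310292984, 25, 233, 253⟩,
   ⟨10759442698238878904428781082296, 32, 131, 231⟩,
   ⟨2214615972165724021104281210724, 44, 72, 252⟩,
   ⟨2515803478383797541003768660420, 129, 172, 191⟩, ⟨43033991615899049952988051899924, 9, 9, 61⟩,
   ⟨25494652930263731774238629000952, 17, 28, 31⟩, ⟨20509128378613045280501535885668, 11, 16, 63⟩,
   ⟨570645131523838772675960125472, 115, 120, 123⟩,
   ⟨23568166694263729623396781306850, 225, 236, 239⟩,
   ⟨18370062323184207296127768872436, 13, 41, 61⟩,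
   ⟨14806977548984614534809813646032, 161, 164, 167⟩,
   ⟨26643885262801343077571435208398, 77, 105, 125⟩,
   ⟨20447930883594770889205220232536, 29, 201, 253⟩,
   ⟨104972183016043857622102702138, 153, 201, 253⟩,
   ⟨26687884688188393815420386160734, 12, 232, 252⟩,
   ⟨6308928846278371881907811250936, 139, 168, 191⟩,
   ⟨16486388529704580758534681148492, 3, 48, 55⟩, ⟨14433364612251819191573927776632, 72, 72, 124⟩,
   ⟨3040640024645586687388651541546, 19, 176, 251⟩,
   ⟨12594224705658305304008965206536, 3, 224, 235⟩,
   ⟨20998311080140957627386743805328, 17, 24, 27⟩, ⟨27160736303820752906355999719826, 65, 68, 71⟩,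
   ⟨1832666565507979141884871256678, 151, 152, 159⟩,
   ⟨39980741544386452481897102870644, 96, 96, 103⟩,
   ⟨24482412223845654919910233116198, 73, 76, 79⟩,
   ⟨22475815028392178135736800875388, 208, 208, 215⟩,
   ⟨19821879271376150372076542340908, 144, 163, 183⟩,
   ⟨24431455097761202367884318813888, 25, 41, 61⟩,
   ⟨6373053780025324990335653485516, 75, 112, 127⟩,
   ⟨3804768027373646240616415588781, 199, 203, 207⟩,
   ⟨12315945872830639897932472219022, 241, 248, 251⟩,
   ⟨2727204122990361806958671900640, 25, 73, 253⟩,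
   ⟨47714979770840018424647069372730, 129, 180, 183⟩,
   ⟨16507831047534226981691104294966, 81, 88, 91⟩, ⟨43925173609937071029645786403046, 8, 8, 60⟩,
   ⟨203136840820578253591488392562, 209, 216, 219⟩,
   ⟨7356903303336148496478960888254, 37, 65, 245⟩,
   ⟨309522435659913190762815744479, 192, 192, 199⟩,
   ⟨24894840682549705058272726710662, 145, 148, 151⟩,
   ⟨9175683210285920376565975822044, 177, 184, 187⟩,
   ⟨9085216613748877646528420490920, 60, 65, 255⟩, ⟨323548704326271333850931651606, 83, 147, 243⟩,
   ⟨40843650775058467847944737320356, 69, 72, 79⟩, ⟨46513406422643041374175340404150, 33, 36, 39⟩,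
   ⟨11415174794657199283489941587852, 24, 200, 252⟩,
   ⟨3823962568450348791668996592372, 49, 81, 241⟩, ⟨3980592146412712040523410551096, 5, 8, 15⟩,
   ⟨9719633778377640442687585303212, 153, 156, 159⟩,
   ⟨18811447413722479697999117708510, 239, 247, 255⟩,
   ⟨9456964782201217021794651918718, 165, 168, 175⟩, ⟨841249717385583291847550421452, 35, 40, 43⟩,
   ⟨11554530586307253939236536598004, 12, 104, 252⟩,
   ⟨3534033910978392056769263452532, 133, 224, 231⟩,
   ⟨16340292975396683834293703215571, 160, 160, 171⟩,
   ⟨31476477793082326212446076186154, 212, 216, 223⟩,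
   ⟨6475616009539559850442984882572, 80, 80, 87⟩,
   ⟨4344515013423197092126574326686, 209, 212, 215⟩,
   ⟨17010371772306149761448303138820, 73, 157, 253⟩,
   ⟨7609536054747292481232831177562, 201, 204, 207⟩, ⟨2887844241843461689204760045462, 9, 20, 63⟩,
   ⟨6255607189531166973352628611560, 136, 165, 191⟩,
   ⟨5577202413720140786712027036174, 20, 24, 31⟩]

theorem chainStart_check : checkCert 8 [7, 11, 52, 224] (2 ^ 128) 2
    (chainFun [12747326465131865887119314500476, 12747326465131865887119314500476,
  16389111783780685669516098021012, 7587603452086032307792570703725,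
  14589712758894246595404147081191, 11839612025565488721451595713697,
  49160736392694231833757340994, 4692964803400036056421347749525]
      [(-1, [2, 4, 5, 6, 7])])
    (expand [[0, 1, 2, 3, 4, 5, 6, 7], [1, 0, 2, 3, 4, 5, 6, 7]] chainStartCuts) = true := by
  decide +kernel

/-- Cuts certifying the chain inequality with edges 012 234 456. -/
def chainStepCuts : List Cut :=
  [⟨35485884205052278028432945875222, 64, 64, 92⟩, ⟨692338975076040032016950853646, 70, 74, 94⟩,
   ⟨4339624242973615118186550668140, 3, 96, 119⟩, ⟨1821322423104233811196433831752, 17, 18, 23⟩,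
   ⟨1455205801911542982009866900206, 114, 121, 127⟩,
   ⟨4689290989441722980559435181564, 33, 77, 125⟩, ⟨2167075250992327040415434378512, 38, 74, 126⟩,
   ⟨5042115032064985518547290357928, 36, 50, 63⟩, ⟨25471633824135097483296992306274, 65, 65, 93⟩,
   ⟨383067187497788061391873322062, 65, 84, 95⟩, ⟨9635238890606090197024344718820, 6, 18, 30⟩,
   ⟨2883157994709693729065913446750, 9, 97, 125⟩, ⟨32353058345670986103804082595812, 34, 34, 62⟩,
   ⟨577686768747296979269529179560, 1, 100, 119⟩,
   ⟨3828252951693924922815515525084, 105, 106, 111⟩, ⟨11766629879903316635502199138200, 7, 8, 31⟩,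
   ⟨2998578325530473371633657205810, 2, 12, 31⟩, ⟨278996093728551523751110707718, 97, 100, 103⟩,
   ⟨6764359882981074354554997056974, 10, 18, 30⟩, ⟨4713993602044257089865710741364, 37, 41, 61⟩,
   ⟨4252452190179823373660822769412, 9, 100, 127⟩, ⟨25356854215665775317773455457768, 66, 66, 94⟩,
   ⟨5402197436728984686737976121440, 3, 72, 127⟩, ⟨6581122036907051398619454680068, 4, 16, 28⟩,
   ⟨155794883079359076823967007126, 34, 49, 63⟩, ⟨11444523777802325054643627119342, 14, 98, 126⟩,
   ⟨25333719659353898875233924332614, 33, 33, 61⟩, ⟨792660707921764709153628655028, 46, 66, 126⟩,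
   ⟨1345333762556435307902844496868, 24, 72, 120⟩, ⟨4403215589764803954244556612058, 41, 50, 63⟩,
   ⟨266875703981298033583088381188, 72, 83, 95⟩, ⟨934662741232389088856251971908, 73, 74, 79⟩,
   ⟨7659285089245934148110478422826, 13, 97, 125⟩, ⟨6569193444544237967364246170028, 71, 71, 95⟩,
   ⟨7912318053657592119177358099620, 4, 4, 116⟩, ⟨6518722065337362112872132233862, 39, 48, 63⟩,
   ⟨107892789842194411765994282950, 25, 66, 127⟩, ⟨11692408976653367787122644216006, 4, 104, 124⟩,
   ⟨5519545476357977625277637734686, 114, 120, 127⟩,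
   ⟨5049781527912977637437685787552, 11, 11, 123⟩, ⟨3745491431697225298861290149740, 69, 72, 95⟩,
   ⟨5128939816002057144396498962886, 15, 39, 127⟩, ⟨260699230306023988201654991402, 72, 80, 92⟩,
   ⟨806391450905830226040762478908, 3, 16, 31⟩, ⟨3967079329210529958116438043210, 42, 50, 62⟩,
   ⟨3178121046769353191377323412792, 6, 50, 126⟩,
   ⟨5495278845095185534515295371510, 115, 120, 127⟩,
   ⟨4439457496042254617937948745118, 40, 48, 60⟩, ⟨469876050467773383440234528638, 68, 73, 95⟩,
   ⟨45490378063941101062851574592928, 0, 0, 28⟩, ⟨189229644125540317041360954680, 9, 65, 125⟩,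
   ⟨5635901149589095720359806137800, 66, 89, 95⟩, ⟨2019870290074052575491655475670, 34, 57, 63⟩,
   ⟨873768423601664591603636692658, 19, 64, 119⟩, ⟨1873935236661163038094459582938, 26, 74, 122⟩,
   ⟨11834226163142767698416373248480, 37, 49, 61⟩, ⟨11940790462587639413392473708932, 5, 17, 29⟩,
   ⟨3200971112587636096023435135562, 10, 17, 31⟩, ⟨1188633560046313050326298523386, 41, 65, 125⟩,
   ⟨4553952758392130447313198074032, 8, 96, 124⟩, ⟨14146879281146563770823782023786, 71, 80, 95⟩,
   ⟨3442248670921120419303708536886, 9, 49, 125⟩, ⟨10757726470105991063327617768, 2, 25, 31⟩,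
   ⟨10446632173963069260302468596576, 67, 88, 95⟩, ⟨9299366664339219964792984503674, 68, 80, 92⟩,
   ⟨9419024050551147958636707340662, 3, 24, 31⟩, ⟨11970416330540470701806001220364, 70, 82, 94⟩,
   ⟨5391931651008506844711621095106, 15, 103, 127⟩, ⟨2286612695595902047110741454338, 40, 40, 47⟩,
   ⟨10487781183485353971021983475302, 35, 56, 63⟩, ⟨8089788862966694090655129390172, 23, 39, 119⟩,
   ⟨7305939269029281693174582307218, 38, 42, 62⟩, ⟨3839611352298471926092104843076, 9, 112, 127⟩,
   ⟨2118819826724739994090764368038, 40, 72, 120⟩, ⟨6505138366742146875003147736696, 73, 81, 93⟩,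
   ⟨24296751834424579508752496575136, 112, 112, 124⟩,
   ⟨811864423399265232714143423790, 68, 74, 95⟩, ⟨2821731346482035280575243831698, 38, 70, 118⟩,
   ⟨5972203975689829061487405683220, 43, 75, 123⟩, ⟨3779137258818844152798489913754, 74, 82, 94⟩,
   ⟨4211811898863624424584867049892, 38, 48, 63⟩, ⟨18080168281074643545500821080662, 7, 16, 31⟩,
   ⟨2838661194301415822815223804908, 8, 19, 31⟩, ⟨1500848179934929542815424958638, 40, 68, 124⟩,
   ⟨36380921334870151496582733661116, 32, 32, 60⟩, ⟨9377931123998924336104590781860, 36, 48, 60⟩,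
   ⟨2903373386536744652461236562244, 21, 69, 117⟩, ⟨1316019724653999306537162063436, 68, 72, 92⟩,
   ⟨8316872096730797344120985146, 29, 60, 127⟩, ⟨5223279548156127094777064569664, 35, 40, 63⟩,
   ⟨1246424595024810257180034720104, 1, 98, 119⟩, ⟨4747875279579393652550974166692, 30, 114, 126⟩,
   ⟨2254085128743190010465481624656, 12, 96, 124⟩, ⟨1672753553784308381509663783630, 2, 112, 119⟩,
   ⟨36567184576826356540701479428344, 2, 2, 30⟩, ⟨34550613833070075529446520675024, 1, 1, 29⟩,
   ⟨2464374214268749604985474392760, 34, 56, 63⟩, ⟨11435545750285411024567443238, 37, 65, 125⟩,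
   ⟨225239884305255683040251476958, 66, 88, 95⟩, ⟨8789429914674162121917762228706, 15, 96, 127⟩,
   ⟨9571075578008085258566355687136, 113, 113, 125⟩,
   ⟨389879571909350286484535987526, 19, 67, 115⟩, ⟨1471814607733358383361129070562, 73, 76, 79⟩,
   ⟨1292972661044588714527367200766, 13, 33, 125⟩, ⟨8086153941950742551859783763926, 69, 81, 93⟩,
   ⟨2000693094653410814616199268506, 39, 60, 63⟩, ⟨11801852150010261068811519799144, 6, 114, 126⟩,
   ⟨11122388295400356260832419496466, 5, 113, 125⟩,
   ⟨4853280279552852642465892367628, 12, 32, 124⟩, ⟨802565437483875271772409295560, 5, 33, 125⟩,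
   ⟨710631014236366061828667752652, 8, 16, 28⟩, ⟨3657148589135665431804515492470, 36, 68, 116⟩,
   ⟨3005039790626105608115884198712, 10, 98, 126⟩, ⟨99575917745463614421873297804, 17, 42, 127⟩,
   ⟨2703080830169734877745921930980, 10, 102, 126⟩]

theorem chainStep_check : checkCert 7 [7, 28, 112] (2 ^ 128) 1
    (chainFun [4561594575596519184942620510822, 0, 9648496356314484842501183296915,
  17058891773977912898569340472348, 9652264498361544878966058798617, 0,
  4569130859690639257872371514226]
      [(1, [0, 1, 2, 3, 4]), (-1, [2, 3, 4, 5, 6])])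
    (expand [[0, 1, 2, 3, 4, 5, 6]] chainStepCuts) = true := by
  decide +kernel

/-- Cuts certifying the chain inequality with edges 012 234. -/
def chainEndCuts : List Cut :=
  [⟨44680650861178746924396109812, 6, 10, 30⟩, ⟨136190167397703003389627971884, 5, 9, 29⟩]

theorem chainEnd_check : checkCert 5 [7, 28] (2 ^ 128) 1
    (chainFun [0, 7536284094120072929751003404, 0, 7536284094120072929751003404, 0]
      [(1, [0, 1, 2, 3, 4]), (1, [4, 3, 2, 1, 0])])
    (expand [[0, 1, 2, 3, 4], [4, 3, 2, 1, 0]] chainEndCuts) = true := by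
  decide +kernel

/-- `{a, b, c}` is a 3-set of the family `F`. -/
structure Tri (F : Finset (Finset ℕ)) (a b c : ℕ) : Prop where
  mem : {a, b, c} ∈ F
  ne₁₂ : a ≠ b
  ne₁₃ : a ≠ c
  ne₂₃ : b ≠ c

theorem Tri.swap {F : Finset (Finset ℕ)} {a b c : ℕ} (h : Tri F a b c) : Tri F b a c :=
  ⟨by rw [Finset.insert_comm]; exact h.mem, h.ne₁₂.symm, h.ne₂₃, h.ne₁₃⟩

theorem Tri.swap' {F : Finset (Finset ℕ)} {a b c : ℕ} (h : Tri F a b c) : Tri F a c b :=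
  ⟨by rw [Finset.pair_comm]; exact h.mem, h.ne₁₃, h.ne₁₂, h.ne₂₃.symm⟩

theorem Counterexample.false_of_flower {F : Finset (Finset ℕ)} (hF : Counterexample F)
    {a b c d e f g : ℕ} (h : [a, b, c, d, e, f, g].Nodup) (h₁ : Tri F a b c) (h₂ : Tri F a d e)
    (h₃ : Tri F a f g) : False :=
  hF.false_of_checkCert h (by simp [maskSet, h₁.mem, h₂.mem, h₃.mem]) (by simp) (by simp)
    flower_check

theorem Counterexample.false_of_fanDisjoint {F : Finset (Finset ℕ)} (hF : Counterexample F)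
    {a b c d e f : ℕ} (h : [a, b, c, d, e, f].Nodup) (h₁ : Tri F a b c) (h₂ : Tri F a b d)
    (h₃ : Tri F a e f) : False :=
  hF.false_of_checkCert h (by simp [maskSet, h₁.mem, h₂.mem, h₃.mem]) (by simp) (by simp)
    fanDisjoint_check

theorem Counterexample.false_of_star {F : Finset (Finset ℕ)} (hF : Counterexample F)
    {a b c d e : ℕ} (h : [a, b, c, d, e].Nodup) (h₁ : Tri F a b c) (h₂ : Tri F a b d)
    (h₃ : Tri F a b e) : False :=
  hF.false_of_checkCert h (by simp [maskSet, h₁.mem, h₂.mem, h₃.mem]) (by simp) (by simp)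
    star_check

theorem Counterexample.false_of_fanPath {F : Finset (Finset ℕ)} (hF : Counterexample F)
    {a b c d e : ℕ} (h : [a, b, c, d, e].Nodup) (h₁ : Tri F a b c) (h₂ : Tri F a b d)
    (h₃ : Tri F a c e) : False :=
  hF.false_of_checkCert h (by simp [maskSet, h₁.mem, h₂.mem, h₃.mem]) (by simp) (by simp)
    fanPath_check

theorem Counterexample.false_of_triangle {F : Finset (Finset ℕ)} (hF : Counterexample F)
    {a b c d : ℕ} (h : [a, b, c, d].Nodup) (h₁ : Tri F a b c) (h₂ : Tri F a b d)
    (h₃ : Tri F a c d) : False :=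
  hF.false_of_checkCert h (by simp [maskSet, h₁.mem, h₂.mem, h₃.mem]) (by simp) (by simp)
    triangle_check

theorem Counterexample.false_of_spider0 {F : Finset (Finset ℕ)} (hF : Counterexample F)
    {a b c d e f g i k : ℕ} (h : [a, b, c, d, e, f, g, i, k].Nodup) (h₁ : Tri F a b c)
    (h₂ : Tri F a d e) (h₃ : Tri F b f g) (h₄ : Tri F c i k) : False :=
  hF.false_of_checkCert h (by simp [maskSet, h₁.mem, h₂.mem, h₃.mem, h₄.mem]) (by simp) (by simp)
    spider0_check

theorem Counterexample.false_of_spider1 {F : Finset (Finset ℕ)} (hF : Counterexample F)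
    {a b c d e f g i : ℕ} (h : [a, b, c, d, e, f, g, i].Nodup) (h₁ : Tri F a b c)
    (h₂ : Tri F a d e) (h₃ : Tri F b d f) (h₄ : Tri F c g i) : False :=
  hF.false_of_checkCert h (by simp [maskSet, h₁.mem, h₂.mem, h₃.mem, h₄.mem]) (by simp) (by simp)
    spider1_check

theorem Counterexample.false_of_spider2 {F : Finset (Finset ℕ)} (hF : Counterexample F)
    {a b c d e f g : ℕ} (h : [a, b, c, d, e, f, g].Nodup) (h₁ : Tri F a b c) (h₂ : Tri F a d e)
    (h₃ : Tri F b d f) (h₄ : Tri F c f g) : False :=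
  hF.false_of_checkCert h (by simp [maskSet, h₁.mem, h₂.mem, h₃.mem, h₄.mem]) (by simp) (by simp)
    spider2_check

theorem Counterexample.false_of_spider3 {F : Finset (Finset ℕ)} (hF : Counterexample F)
    {a b c d e f : ℕ} (h : [a, b, c, d, e, f].Nodup) (h₁ : Tri F a b c) (h₂ : Tri F a d e)
    (h₃ : Tri F b d f) (h₄ : Tri F c e f) : False :=
  hF.false_of_checkCert h (by simp [maskSet, h₁.mem, h₂.mem, h₃.mem, h₄.mem]) (by simp) (by simp)
    spider3_check

theorem Counterexample.false_of_pairTail {F : Finset (Finset ℕ)} (hF : Counterexample F)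
    {a b c d e : ℕ} (h : [a, b, c, d, e].Nodup) (h₁ : Tri F a b c) (h₂ : Tri F a b d)
    (h₃ : Tri F c d e) : False :=
  hF.false_of_checkCert h (by simp [maskSet, h₁.mem, h₂.mem, h₃.mem]) (by simp) (by simp)
    pairTail_check

theorem Counterexample.false_of_twin2 {F : Finset (Finset ℕ)} (hF : Counterexample F)
    {a b c d e f : ℕ} (h : [a, b, c, d, e, f].Nodup) (h₁ : Tri F a b c) (h₂ : Tri F a b d)
    (h₃ : Tri F c e f) (h₄ : Tri F d e f) : False :=
  hF.false_of_checkCert h (by simp [maskSet, h₁.mem, h₂.mem, h₃.mem, h₄.mem]) (by simp) (by simp)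
    twin2_check

theorem Counterexample.false_of_twin1 {F : Finset (Finset ℕ)} (hF : Counterexample F)
    {a b c d e f g : ℕ} (h : [a, b, c, d, e, f, g].Nodup) (h₁ : Tri F a b c) (h₂ : Tri F a b d)
    (h₃ : Tri F c e f) (h₄ : Tri F d f g) : False :=
  hF.false_of_checkCert h (by simp [maskSet, h₁.mem, h₂.mem, h₃.mem, h₄.mem]) (by simp) (by simp)
    twin1_check

theorem Counterexample.false_of_twin0 {F : Finset (Finset ℕ)} (hF : Counterexample F)
    {a b c d e f g i : ℕ} (h : [a, b, c, d, e, f, g, i].Nodup) (h₁ : Tri F a b c)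
    (h₂ : Tri F a b d) (h₃ : Tri F c e f) (h₄ : Tri F d g i) : False :=
  hF.false_of_checkCert h (by simp [maskSet, h₁.mem, h₂.mem, h₃.mem, h₄.mem]) (by simp) (by simp)
    twin0_check

theorem Counterexample.false_of_dumbbell0 {F : Finset (Finset ℕ)} (hF : Counterexample F)
    {a b c d e f g : ℕ} (h : [a, b, c, d, e, f, g].Nodup) (h₁ : Tri F a b c) (h₂ : Tri F a b d)
    (h₃ : Tri F c e f) (h₄ : Tri F e f g) : False :=
  hF.false_of_checkCert h (by simp [maskSet, h₁.mem, h₂.mem, h₃.mem, h₄.mem]) (by simp) (by simp)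
    dumbbell0_check

theorem Counterexample.false_of_dumbbell1 {F : Finset (Finset ℕ)} (hF : Counterexample F)
    {a b c d e f g i k : ℕ} (h : [a, b, c, d, e, f, g, i, k].Nodup) (h₁ : Tri F a b c)
    (h₂ : Tri F a b d) (h₃ : Tri F c e f) (h₄ : Tri F f g i) (h₅ : Tri F g i k) : False :=
  hF.false_of_checkCert h (by simp [maskSet, h₁.mem, h₂.mem, h₃.mem, h₄.mem, h₅.mem])
    (by simp) (by simp)
    dumbbell1_check

theorem Counterexample.chainStart {F : Finset (Finset ℕ)} (hF : Counterexample F)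
    {a b c d e f g i : ℕ} (h : [a, b, c, d, e, f, g, i].Nodup) (h₁ : Tri F a b c)
    (h₂ : Tri F a b d) (h₃ : Tri F c e f) (h₄ : Tri F f g i) :
    totalPotential F [c, e, f, g, i] ≤ 0 := by
  have := hF.sum_potential_nonneg h (by simp [maskSet, h₁.mem, h₂.mem, h₃.mem, h₄.mem])
    (by simp) (by simp) chainStart_check
  simp at this
  omega

theorem Counterexample.chainStep {F : Finset (Finset ℕ)} (hF : Counterexample F)
    {a b c d e f g : ℕ} (h : [a, b, c, d, e, f, g].Nodup) (h₁ : Tri F a b c) (h₂ : Tri F c d e)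
    (h₃ : Tri F e f g) : totalPotential F [c, d, e, f, g] ≤ totalPotential F [a, b, c, d, e] := by
  have := hF.sum_potential_nonneg h (by simp [maskSet, h₁.mem, h₂.mem, h₃.mem])
    (by simp) (by simp) chainStep_check
  simp at this
  omega

theorem Counterexample.chainEnd {F : Finset (Finset ℕ)} (hF : Counterexample F)
    {a b c d e : ℕ} (h : [a, b, c, d, e].Nodup) (h₁ : Tri F a b c) (h₂ : Tri F c d e) :
    0 < totalPotential F [a, b, c, d, e] + totalPotential F [e, d, c, b, a] := by
  have := hF.sum_potential_nonneg h (by simp [maskSet, h₁.mem, h₂.mem])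
    (by simp) (by simp) chainEnd_check
  simp at this
  omega

theorem Tri.ne {F : Finset (Finset ℕ)} {a b c : ℕ} (h : Tri F a b c) : a ≠ b ∧ a ≠ c ∧ b ≠ c :=
  ⟨h.ne₁₂, h.ne₁₃, h.ne₂₃⟩

theorem Tri.mono {T F : Finset (Finset ℕ)} (hTF : T ⊆ F) {a b c : ℕ} (h : Tri T a b c) :
    Tri F a b c :=
  ⟨hTF h.mem, h.ne₁₂, h.ne₁₃, h.ne₂₃⟩

theorem exists_tri {T : Finset (Finset ℕ)} {f : Finset ℕ} {v : ℕ} (hf : f ∈ T)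
    (h3 : f.card = 3) (hv : v ∈ f) : ∃ x y, Tri T v x y ∧ f = {v, x, y} := by
  obtain ⟨a, b, c, hab, hac, hbc, rfl⟩ := Finset.card_eq_three.1 h3
  simp only [Finset.mem_insert, Finset.mem_singleton] at hv
  have h : Tri T a b c := ⟨hf, hab, hac, hbc⟩
  rcases hv with rfl | rfl | rfl
  · exact ⟨b, c, h, rfl⟩
  · exact ⟨a, c, h.swap, Finset.insert_comm ..⟩
  · exact ⟨a, b, h.swap'.swap, by grind [Tri.ne]⟩

theorem exists_tri_of_ne {T : Finset (Finset ℕ)} {f : Finset ℕ} {v w : ℕ} (hf : f ∈ T)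
    (h3 : f.card = 3) (hv : v ∈ f) (hw : w ∈ f) (hvw : v ≠ w) :
    ∃ x, Tri T v w x ∧ f = {v, w, x} := by
  obtain ⟨x, y, h, rfl⟩ := exists_tri hf h3 hv
  simp only [Finset.mem_insert, Finset.mem_singleton] at hw
  rcases hw with rfl | rfl | rfl
  · exact absurd rfl hvw
  · exact ⟨y, h, rfl⟩
  · exact ⟨x, h.swap', by grind [Tri.ne]⟩

theorem Counterexample.false_of_fan {F : Finset (Finset ℕ)} (hF : Counterexample F)
    {v a b c e f : ℕ} (h₁ : Tri F v a b) (h₂ : Tri F v a c) (hbc : b ≠ c) (h₃ : Tri F v e f)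
    (hb : ({v, e, f} : Finset ℕ) ≠ {v, a, b}) (hc : ({v, e, f} : Finset ℕ) ≠ {v, a, c}) :
    False := by
  have key : ∀ e f, Tri F v e f → ({v, e, f} : Finset ℕ) ≠ {v, a, b} →
      ({v, e, f} : Finset ℕ) ≠ {v, a, c} → f ≠ a → f ≠ c → (f = b → e = c) → False := by
    intro e f h₃ hb hc hfa hfc hfb
    by_cases hea : e = a
    · subst hea
      exact hF.false_of_star (by simp; grind [Tri.ne]) h₁ h₂ h₃
    by_cases hec : e = c
    · subst hec
      by_cases hfb : f = b
      · subst hfb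
        exact hF.false_of_triangle (by simp; grind [Tri.ne]) h₁ h₂ h₃.swap'
      · exact hF.false_of_fanPath (by simp; grind [Tri.ne]) h₂ h₁ h₃
    by_cases heb : e = b
    · subst heb
      exact hF.false_of_fanPath (by simp; grind [Tri.ne]) h₁ h₂ h₃
    exact hF.false_of_fanDisjoint (by simp; grind [Tri.ne]) h₁ h₂ h₃
  by_cases h : f ≠ a ∧ f ≠ c ∧ (f = b → e = c)
  · exact key e f h₃ hb hc h.1 h.2.1 h.2.2
  · refine key f e h₃.swap' ?_ ?_ ?_ ?_ ?_ <;> grind [Tri.ne]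

/-- In a counterexample no vertex lies in three members of size three. -/
theorem Counterexample.eq_of_mem {F : Finset (Finset ℕ)} (hF : Counterexample F) {v : ℕ}
    {f g h : Finset ℕ} (hf : f ∈ F) (hg : g ∈ F) (hh : h ∈ F) (hf3 : f.card = 3)
    (hg3 : g.card = 3) (hh3 : h.card = 3) (hvf : v ∈ f) (hvg : v ∈ g) (hvh : v ∈ h)
    (hfg : f ≠ g) (hfh : f ≠ h) : g = h := by
  by_contra hgh
  obtain ⟨a, b, h₁, rfl⟩ := exists_tri hf hf3 hvf
  obtain ⟨c, d, h₂, rfl⟩ := exists_tri hg hg3 hvg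
  obtain ⟨i, j, h₃, rfl⟩ := exists_tri hh hh3 hvh
  have key : ∀ {f g h : Finset ℕ} {w}, f ∈ F → g ∈ F → h ∈ F → f.card = 3 → g.card = 3 →
      h.card = 3 → v ∈ f → v ∈ g → v ∈ h → w ∈ f → w ∈ g → w ≠ v → f ≠ g → f ≠ h → g ≠ h →
      False := by
    intro f g h w hf hg hh hf3 hg3 hh3 hvf hvg hvh hwf hwg hwv hfg hfh hgh
    obtain ⟨x, h₁, rfl⟩ := exists_tri_of_ne hf hf3 hvf hwf hwv.symm
    obtain ⟨y, h₂, rfl⟩ := exists_tri_of_ne hg hg3 hvg hwg hwv.symm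
    obtain ⟨p, q, h₃, rfl⟩ := exists_tri hh hh3 hvh
    exact hF.false_of_fan h₁ h₂ (by grind [Tri.ne]) h₃ hfh.symm hgh.symm
  by_cases hac : ∃ w, w ∈ ({v, a, b} : Finset ℕ) ∧ w ∈ ({v, c, d} : Finset ℕ) ∧ w ≠ v
  · obtain ⟨w, hw, hw', hwv⟩ := hac
    exact key hf hg hh hf3 hg3 hh3 hvf hvg hvh hw hw' hwv hfg hfh hgh
  by_cases hai : ∃ w, w ∈ ({v, a, b} : Finset ℕ) ∧ w ∈ ({v, i, j} : Finset ℕ) ∧ w ≠ v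
  · obtain ⟨w, hw, hw', hwv⟩ := hai
    exact key hf hh hg hf3 hh3 hg3 hvf hvh hvg hw hw' hwv hfh hfg (Ne.symm hgh)
  by_cases hci : ∃ w, w ∈ ({v, c, d} : Finset ℕ) ∧ w ∈ ({v, i, j} : Finset ℕ) ∧ w ≠ v
  · obtain ⟨w, hw, hw', hwv⟩ := hci
    exact key hg hh hf hg3 hh3 hf3 hvg hvh hvf hw hw' hwv hgh hfg.symm hfh.symm
  refine hF.false_of_flower (a := v) (b := a) (c := b) (d := c) (e := d) (f := i) (g := j) ?_
    h₁ h₂ h₃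
  simp only [not_exists, not_and, Finset.mem_insert, Finset.mem_singleton] at hac hai hci
  have ha := hac a
  have hb := hac b
  have ha' := hai a
  have hb' := hai b
  have hc := hci c
  have hd := hci d
  clear key hac hai hci
  simp
  grind [Tri.ne]

theorem triple_right_comm (a b c : ℕ) : ({a, c, b} : Finset ℕ) = {a, b, c} := by
  rw [Finset.pair_comm]

theorem Counterexample.false_of_spider_of_meet {F : Finset (Finset ℕ)} (hF : Counterexample F)
    {a b c d e f g i : ℕ} (h₁ : Tri F a b c) (h₂ : Tri F a d e) (h₃ : Tri F b d f)
    (h₄ : Tri F c g i) (ha : a ∉ [d, f, g, i]) (hb : b ∉ [d, e, g, i]) (hc : c ∉ [d, e, f])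
    (hd : d ∉ [g, i]) : False := by
  simp only [List.mem_cons, List.not_mem_nil, or_false, not_or] at ha hb hc hd
  by_cases hef : e = f
  · subst hef
    exact hF.false_of_pairTail (a := d) (b := e) (c := a) (d := b) (e := c) (by simp; grind [Tri.ne])
      h₂.swap.swap' h₃.swap.swap' h₁
  have key : ∀ g i, Tri F c g i → g ∉ [a, b, d] → i ∉ [a, b, d] → g ≠ e → (i = e → g = f) →
      False := by
    intro g i h₄ hg hi hge hie
    simp only [List.mem_cons, List.not_mem_nil, or_false, not_or] at hg hi
    by_cases hgf : g = f
    · subst hgf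
      by_cases hie : i = e
      · subst hie
        exact hF.false_of_spider3 (by simp; grind [Tri.ne]) h₁ h₂ h₃ h₄.swap'
      · exact hF.false_of_spider2 (by simp; grind [Tri.ne]) h₁ h₂ h₃ h₄
    by_cases hif : i = f
    · subst hif
      exact hF.false_of_spider2 (by simp; grind [Tri.ne]) h₁ h₂ h₃ h₄.swap'
    · exact hF.false_of_spider1 (by simp; grind [Tri.ne]) h₁ h₂ h₃ h₄
  by_cases hg : g ≠ e ∧ (i = e → g = f)
  · exact key g i h₄ (by simp; grind [Tri.ne]) (by simp; grind [Tri.ne]) hg.1 hg.2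
  by_cases hi : i ≠ e ∧ (g = e → i = f)
  · exact key i g h₄.swap' (by simp; grind [Tri.ne]) (by simp; grind [Tri.ne]) hi.1 hi.2
  by_cases hge : g = e
  · subst hge
    exact hF.false_of_spider2 (a := b) (b := a) (e := f) (f := g) (g := i)
      (by simp; grind [Tri.ne]) h₁.swap h₃ h₂ h₄
  · obtain rfl : i = e := by grind [Tri.ne]
    exact hF.false_of_spider2 (a := b) (b := a) (e := f) (f := i) (g := g)
      (by simp; grind [Tri.ne]) h₁.swap h₃ h₂ h₄.swap'

/-- A family of three-element members of a counterexample. -/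
structure TripleSystem (F T : Finset (Finset ℕ)) : Prop where
  counterexample : Counterexample F
  subset : T ⊆ F
  card_eq : ∀ f ∈ T, f.card = 3

namespace TripleSystem

variable {F T : Finset (Finset ℕ)}

theorem notMem (hT : TripleSystem F T) {f g h : Finset ℕ} {v : ℕ} (hf : f ∈ T) (hg : g ∈ T)
    (hh : h ∈ T) (hvf : v ∈ f) (hvg : v ∈ g) (hfg : f ≠ g) (hfh : h ≠ f) (hgh : h ≠ g) : v ∉ h :=
  fun hvh => hgh.symm (hT.counterexample.eq_of_mem (hT.subset hf) (hT.subset hg) (hT.subset hh)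
    (hT.card_eq f hf) (hT.card_eq g hg) (hT.card_eq h hh) hvf hvg hvh hfg hfh.symm)

theorem false_of_spider (hT : TripleSystem F T) {a b c : ℕ} (h : Tri T a b c)
    {f g k : Finset ℕ} (hf : f ∈ T) (hg : g ∈ T) (hk : k ∈ T) (haf : a ∈ f) (hbg : b ∈ g)
    (hck : c ∈ k) (hf' : f ≠ {a, b, c}) (hg' : g ≠ {a, b, c}) (hk' : k ≠ {a, b, c})
    (hfg : f ≠ g) (hfk : f ≠ k) (hgk : g ≠ k) : False := by
  have key : ∀ {a b c : ℕ} {f g k : Finset ℕ} {d : ℕ}, Tri T a b c → f ∈ T → g ∈ T → k ∈ T →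
      a ∈ f → b ∈ g → c ∈ k → f ≠ {a, b, c} → g ≠ {a, b, c} → k ≠ {a, b, c} → f ≠ g → f ≠ k →
      g ≠ k → d ∈ f → d ∈ g → False := by
    intro a b c f g k d h hf hg hk haf hbg hck hf' hg' hk' hfg hfk hgk hdf hdg
    have haf' : a ∉ g := hT.notMem h.mem hf hg (by simp) haf hf'.symm hg' hfg.symm
    have hak : a ∉ k := hT.notMem h.mem hf hk (by simp) haf hf'.symm hk' hfk.symm
    have hbf : b ∉ f := hT.notMem h.mem hg hf (by simp) hbg hg'.symm hf' hfg
    have hbk : b ∉ k := hT.notMem h.mem hg hk (by simp) hbg hg'.symm hk' hgk.symm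
    have hcf : c ∉ f := hT.notMem h.mem hk hf (by simp) hck hk'.symm hf' hfk
    have hcg : c ∉ g := hT.notMem h.mem hk hg (by simp) hck hk'.symm hg' hgk
    have hdk : d ∉ k := hT.notMem hf hg hk hdf hdg hfg hfk.symm hgk.symm
    obtain ⟨e, h₂, rfl⟩ := exists_tri_of_ne hf (hT.card_eq f hf) haf hdf (by grind [Tri.ne])
    obtain ⟨i, h₃, rfl⟩ := exists_tri_of_ne hg (hT.card_eq g hg) hbg hdg (by grind [Tri.ne])
    obtain ⟨x, y, h₄, rfl⟩ := exists_tri hk (hT.card_eq k hk) hck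
    simp only [Finset.mem_insert, Finset.mem_singleton, not_or] at *
    exact hT.counterexample.false_of_spider_of_meet (h.mono hT.subset) (h₂.mono hT.subset)
      (h₃.mono hT.subset) (h₄.mono hT.subset) (by simp; grind [Tri.ne])
      (by simp; grind [Tri.ne]) (by simp; grind [Tri.ne])
      (by simp; grind [Tri.ne])
  by_cases h₁ : ∃ d, d ∈ f ∧ d ∈ g
  · obtain ⟨d, hdf, hdg⟩ := h₁
    exact key h hf hg hk haf hbg hck hf' hg' hk' hfg hfk hgk hdf hdg
  by_cases h₂ : ∃ d, d ∈ f ∧ d ∈ k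
  · obtain ⟨d, hdf, hdk⟩ := h₂
    have : ({a, c, b} : Finset ℕ) = {a, b, c} := triple_right_comm a b c
    exact key h.swap' hf hk hg haf hck hbg (this ▸ hf') (this ▸ hk') (this ▸ hg') hfk hfg hgk.symm
      hdf hdk
  by_cases h₃ : ∃ d, d ∈ g ∧ d ∈ k
  · obtain ⟨d, hdg, hdk⟩ := h₃
    have : ({b, c, a} : Finset ℕ) = {a, b, c} :=
      (triple_right_comm b a c).trans (Finset.insert_comm b a {c})
    exact key h.swap.swap' hg hk hf hbg hck haf (this ▸ hg') (this ▸ hk') (this ▸ hf') hgk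
      hfg.symm hfk.symm hdg hdk
  obtain ⟨p, q, h₄, rfl⟩ := exists_tri hf (hT.card_eq f hf) haf
  obtain ⟨r, s, h₅, rfl⟩ := exists_tri hg (hT.card_eq g hg) hbg
  obtain ⟨x, y, h₆, rfl⟩ := exists_tri hk (hT.card_eq k hk) hck
  have hag := hT.notMem h.mem hf hg (by simp) haf hf'.symm hg' hfg.symm
  have hak := hT.notMem h.mem hf hk (by simp) haf hf'.symm hk' hfk.symm
  have hbf := hT.notMem h.mem hg hf (by simp) hbg hg'.symm hf' hfg
  have hbk := hT.notMem h.mem hg hk (by simp) hbg hg'.symm hk' hgk.symm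
  have hcf := hT.notMem h.mem hk hf (by simp) hck hk'.symm hf' hfk
  have hcg := hT.notMem h.mem hk hg (by simp) hck hk'.symm hg' hgk
  refine hT.counterexample.false_of_spider0 ?_ (h.mono hT.subset) (h₄.mono hT.subset)
    (h₅.mono hT.subset) (h₆.mono hT.subset)
  simp only [not_exists, not_and, Finset.mem_insert, Finset.mem_singleton, not_or] at *
  have hp := h₁ p
  have hq := h₁ q
  have hp' := h₂ p
  have hq' := h₂ q
  have hr := h₃ r
  have hs := h₃ s
  clear h₁ h₂ h₃ key hf' hg' hk' hfg hfk hgk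
  simp
  grind [Tri.ne]

end TripleSystem

/-- A part `R` of a triple system `T`, attached to the rest of `T` at the vertex `c`, in which no
triple has two vertices other than `c` that lie in no other triple of `R`. -/
structure Tail (F T R : Finset (Finset ℕ)) (c : ℕ) : Prop where
  system : TripleSystem F T
  subset : R ⊆ T
  attached : ∃ e ∈ T, e ∉ R ∧ c ∈ e
  exists_mem : ∃ f ∈ R, c ∈ f
  linked : ∀ f ∈ R, ∀ u ∈ f, ∀ v ∈ f, u ≠ v → u ≠ c → v ≠ c → ∃ g ∈ R, g ≠ f ∧ (u ∈ g ∨ v ∈ g)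

namespace Tail

variable {F T R : Finset (Finset ℕ)}

theorem tri {c x y z : ℕ} (hR : Tail F T R c) (h : Tri R x y z) : Tri F x y z :=
  h.mono (hR.subset.trans hR.system.subset)

theorem exists_next {c : ℕ} (hR : Tail F T R c) :
    ∃ x y, Tri R c x y ∧ ((∃ z, Tri R x y z ∧ z ≠ c) ∨
      (Tail F T (R.erase {c, x, y}) x ∧ ∀ g ∈ R.erase {c, x, y}, c ∉ g ∧ y ∉ g)) := by
  have hT := hR.system
  obtain ⟨e, he, heR, hce⟩ := hR.attached
  obtain ⟨f, hf, hcf⟩ := hR.exists_mem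
  have hc : ∀ g ∈ R, g ≠ f → c ∉ g := fun g hg hgf =>
    hT.notMem he (hR.subset hf) (hR.subset hg) hce hcf (fun h => heR (h ▸ hf))
      (fun h => heR (h ▸ hg)) hgf
  obtain ⟨x, y, h, rfl⟩ := exists_tri hf (hT.card_eq f (hR.subset hf)) hcf
  have key : ∀ x y, Tri R c x y → ∀ g ∈ R, g ≠ {c, x, y} → x ∈ g →
      (∀ g ∈ R, g ≠ {c, x, y} → c ∉ g) → ∃ x y, Tri R c x y ∧ ((∃ z, Tri R x y z ∧ z ≠ c) ∨
      (Tail F T (R.erase {c, x, y}) x ∧ ∀ g ∈ R.erase {c, x, y}, c ∉ g ∧ y ∉ g)) := by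
    intro x y h g hg hgf hxg hc
    refine ⟨x, y, h, ?_⟩
    by_cases hyg : y ∈ g
    · obtain ⟨z, h', rfl⟩ := exists_tri_of_ne hg (hT.card_eq g (hR.subset hg)) hxg hyg h.ne₂₃
      exact Or.inl ⟨z, h', fun hz => hc _ hg hgf (by simp [hz])⟩
    have hy : ∀ k ∈ R, k ≠ {c, x, y} → y ∉ k := fun k hk hkf hyk =>
      hT.false_of_spider (h.mono hR.subset) he (hR.subset hg) (hR.subset hk) hce hxg hyk
        (fun h' => heR (h' ▸ h.mem)) hgf hkf (fun h => heR (h ▸ hg)) (fun h => heR (h ▸ hk))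
        (fun h => hyg (h ▸ hyk))
    refine Or.inr ⟨⟨hT, (Finset.erase_subset _ _).trans hR.subset,
      ⟨_, hR.subset h.mem, by simp, by simp⟩, ⟨g, by simp [hg, hgf], hxg⟩, ?_⟩, ?_⟩
    · intro k hk u hu v hv huv hux hvx
      obtain ⟨hkf, hk⟩ := Finset.mem_erase.1 hk
      have hck := hc k hk hkf
      have hyk := hy k hk hkf
      have huc : u ≠ c := fun h => hck (h ▸ hu)
      have hvc : v ≠ c := fun h => hck (h ▸ hv)
      have huy : u ≠ y := fun h => hyk (h ▸ hu)
      have hvy : v ≠ y := fun h => hyk (h ▸ hv)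
      obtain ⟨l, hl, hlk, h'⟩ := hR.linked k hk u hu v hv huv huc hvc
      refine ⟨l, Finset.mem_erase.2 ⟨?_, hl⟩, hlk, h'⟩
      rintro rfl
      simp [*] at h'
    · intro k hk
      obtain ⟨hkf, hk⟩ := Finset.mem_erase.1 hk
      exact ⟨hc k hk hkf, hy k hk hkf⟩
  obtain ⟨g, hg, hgf, hxg | hyg⟩ :=
    hR.linked _ hf x (by simp) y (by simp) h.ne₂₃ h.ne₁₂.symm h.ne₁₃.symm
  · exact key x y h g hg hgf hxg hc
  · rw [← triple_right_comm] at hgf hc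
    exact key y x h.swap' g hg hgf hyg hc

theorem false_of_potential {c p d q e : ℕ} (hR : Tail F T R e) (h₁ : Tri F c p d)
    (h₂ : Tri F d q e) (hn : [c, p, d, q, e].Nodup)
    (hle : totalPotential F [c, p, d, q, e] ≤ 0)
    (hav : ∀ g ∈ R, c ∉ g ∧ p ∉ g ∧ d ∉ g ∧ q ∉ g) : False := by
  induction hm : R.card using Nat.strong_induction_on generalizing R c p d q e with
  | _ m ih =>
    have hF := hR.system.counterexample
    obtain ⟨x, y, h, ⟨z, h', hz⟩ | ⟨hR', hav'⟩⟩ := hR.exists_next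
    · have hs := hF.chainStart (a := x) (b := y) (c := e) (d := z) (e := q) (f := d) (g := p)
        (i := c) (by have := hav _ h.mem; have := hav _ h'.mem; simp at *; grind [Tri.ne])
        (hR.tri h).swap.swap' (hR.tri h') h₂.swap'.swap.swap' h₁.swap'.swap.swap'
      have := hF.chainEnd hn h₁ h₂
      omega
    · have hn' : [c, p, d, q, e, y, x].Nodup := by
        have := hav _ h.mem
        simp at *
        grind [Tri.ne]
      refine ih _ (hm ▸ Finset.card_erase_lt_of_mem h.mem) hR' h₂ (hR.tri h).swap' ?_
        ((hF.chainStep hn' h₁ h₂ (hR.tri h).swap').trans hle) ?_ rfl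
      · simp at *
        grind [Tri.ne]
      · exact fun g hg => ⟨(hav g (Finset.mem_of_mem_erase hg)).2.2.1,
          (hav g (Finset.mem_of_mem_erase hg)).2.2.2, hav' g hg⟩

theorem false_of_twin_link {a b c d p e : ℕ} (hR : Tail F T R e) (h₁ : Tri F a b c)
    (h₂ : Tri F a b d) (h₃ : Tri F c p e) (hn : [a, b, c, d, p, e].Nodup)
    (hav : ∀ g ∈ R, a ∉ g ∧ b ∉ g ∧ c ∉ g ∧ d ∉ g ∧ p ∉ g) : False := by
  have hF := hR.system.counterexample
  obtain ⟨x, y, h, ⟨z, h', hz⟩ | ⟨hR', hav'⟩⟩ := hR.exists_next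
  · refine hF.false_of_dumbbell1 (i := y) (k := z) ?_ h₁ h₂ h₃ (hR.tri h) (hR.tri h')
    have := hav _ h.mem
    have := hav _ h'.mem
    simp at *
    grind [Tri.ne]
  · have hn' : [a, b, c, d, p, e, y, x].Nodup := by
      have := hav _ h.mem
      simp at *
      grind [Tri.ne]
    refine hR'.false_of_potential h₃ (hR.tri h).swap' ?_
      (hF.chainStart hn' h₁ h₂ h₃ (hR.tri h).swap') ?_
    · simp at *
      grind [Tri.ne]
    · exact fun g hg => ⟨(hav g (Finset.mem_of_mem_erase hg)).2.2.1,
        (hav g (Finset.mem_of_mem_erase hg)).2.2.2.2, hav' g hg⟩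

theorem false_of_twin {a b c d : ℕ} (hR : Tail F T R c) (h₁ : Tri F a b c)
    (h₂ : Tri F a b d) (hcd : c ≠ d) (hav : ∀ g ∈ R, a ∉ g ∧ b ∉ g ∧ d ∉ g) : False := by
  have hF := hR.system.counterexample
  obtain ⟨x, y, h, ⟨z, h', hz⟩ | ⟨hR', hav'⟩⟩ := hR.exists_next
  · refine hF.false_of_dumbbell0 (g := z) ?_ h₁ h₂ (hR.tri h) (hR.tri h')
    have := hav _ h.mem
    have := hav _ h'.mem
    simp at *
    grind [Tri.ne]
  · refine hR'.false_of_twin_link h₁ h₂ (hR.tri h).swap' ?_ ?_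
    · have := hav _ h.mem
      simp at *
      grind [Tri.ne]
    · exact fun g hg => ⟨(hav g (Finset.mem_of_mem_erase hg)).1,
        (hav g (Finset.mem_of_mem_erase hg)).2.1, (hav' g hg).1,
        (hav g (Finset.mem_of_mem_erase hg)).2.2, (hav' g hg).2⟩

end Tail

namespace TripleSystem

variable {F T : Finset (Finset ℕ)}

theorem false_of_twin (hT : TripleSystem F T) {a b c d : ℕ} (h₁ : Tri T a b c)
    (h₂ : Tri T a b d) (hcd : c ≠ d) {k : Finset ℕ} (hk : k ∈ T) (hck : c ∈ k)
    (hke : k ≠ {a, b, c})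
    (hl : ∀ f ∈ T, ∀ u ∈ f, ∀ v ∈ f, u ≠ v → ∃ g ∈ T, g ≠ f ∧ (u ∈ g ∨ v ∈ g)) : False := by
  have hF := hT.counterexample
  have hef : ({a, b, c} : Finset ℕ) ≠ {a, b, d} := fun h => by
    have : c ∈ ({a, b, d} : Finset ℕ) := by simp [← h]
    simp at this
    grind [Tri.ne]
  have hab : ∀ g ∈ T, g ≠ {a, b, c} → g ≠ {a, b, d} → a ∉ g ∧ b ∉ g := fun g hg hge hgf =>
    ⟨hT.notMem h₁.mem h₂.mem hg (by simp) (by simp) hef hge hgf,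
      hT.notMem h₁.mem h₂.mem hg (by simp) (by simp) hef hge hgf⟩
  have hce : c ∉ ({a, b, d} : Finset ℕ) := by simp; grind [Tri.ne]
  have hde : d ∉ ({a, b, c} : Finset ℕ) := by simp; grind [Tri.ne]
  have hkf : k ≠ {a, b, d} := fun h => hce (h ▸ hck)
  have hk' := hab k hk hke hkf
  by_cases hd : ∃ g ∈ T, g ≠ {a, b, d} ∧ d ∈ g
  · obtain ⟨g, hg, hgf, hdg⟩ := hd
    have hge : g ≠ {a, b, c} := fun h => hde (h ▸ hdg)
    have hg' := hab g hg hge hgf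
    by_cases hgk : g = k
    · subst hgk
      obtain ⟨w, h₃, rfl⟩ := exists_tri_of_ne hg (hT.card_eq _ hg) hck hdg hcd
      exact hF.false_of_pairTail (e := w) (by simp at *; grind [Tri.ne]) (h₁.mono hT.subset)
        (h₂.mono hT.subset) (h₃.mono hT.subset)
    have hcg : c ∉ g := hT.notMem h₁.mem hk hg (by simp) hck hke.symm hge hgk
    have hdk : d ∉ k := hT.notMem h₂.mem hg hk (by simp) hdg hgf.symm hkf (Ne.symm hgk)
    by_cases hw : ∃ w, w ∈ k ∧ w ∈ g
    · obtain ⟨w, hwk, hwg⟩ := hw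
      obtain ⟨q, h₃, rfl⟩ := exists_tri_of_ne hk (hT.card_eq _ hk) hck hwk (by grind [Tri.ne])
      obtain ⟨s, h₄, rfl⟩ := exists_tri_of_ne hg (hT.card_eq _ hg) hdg hwg (by grind [Tri.ne])
      by_cases hqs : q = s
      · subst hqs
        exact hF.false_of_twin2 (e := w) (f := q) (by simp at *; grind [Tri.ne]) (h₁.mono hT.subset)
          (h₂.mono hT.subset) (h₃.mono hT.subset) (h₄.mono hT.subset)
      · exact hF.false_of_twin1 (e := q) (f := w) (g := s) (by simp at *; grind [Tri.ne])
          (h₁.mono hT.subset) (h₂.mono hT.subset) (h₃.mono hT.subset).swap' (h₄.mono hT.subset)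
    · obtain ⟨p, q, h₃, rfl⟩ := exists_tri hk (hT.card_eq _ hk) hck
      obtain ⟨r, s, h₄, rfl⟩ := exists_tri hg (hT.card_eq _ hg) hdg
      refine hF.false_of_twin0 (e := p) (f := q) (g := r) (i := s) ?_
        (h₁.mono hT.subset) (h₂.mono hT.subset) (h₃.mono hT.subset) (h₄.mono hT.subset)
      simp only [not_exists, not_and] at hw
      have hp := hw p
      have hq := hw q
      clear hab hl hw
      simp at *
      grind [Tri.ne]
  · have hd' : ∀ g ∈ T, g ≠ {a, b, d} → d ∉ g := fun g hg hgf hdg => hd ⟨g, hg, hgf, hdg⟩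
    have hR : Tail F T ((T.erase {a, b, c}).erase {a, b, d}) c := by
      refine ⟨hT, (Finset.erase_subset _ _).trans (Finset.erase_subset _ _),
        ⟨_, h₁.mem, by simp, by simp⟩, ⟨k, by simp [hk, hke, hkf], hck⟩, ?_⟩
      intro l hl' u hu v hv huv huc hvc
      simp only [Finset.mem_erase] at hl'
      obtain ⟨hlf, hle, hlT⟩ := hl'
      obtain ⟨m, hm, hml, h⟩ := hl l hlT u hu v hv huv
      have hal := hab l hlT hle hlf
      have hdl := hd' l hlT hlf
      refine ⟨m, ?_, hml, h⟩
      simp only [Finset.mem_erase]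
      refine ⟨?_, ?_, hm⟩
      · rintro rfl
        simp at h
        grind [Tri.ne]
      · rintro rfl
        simp at h
        grind [Tri.ne]
    refine hR.false_of_twin (h₁.mono hT.subset) (h₂.mono hT.subset) hcd fun g hg => ?_
    simp only [Finset.mem_erase] at hg
    exact ⟨(hab g hg.2.2 hg.2.1 hg.1).1, (hab g hg.2.2 hg.2.1 hg.1).2, hd' g hg.2.2 hg.1⟩

theorem false_of_linked (hT : TripleSystem F T) {e : Finset ℕ} (he : e ∈ T)
    (he' : ∀ v ∈ e, ∃ g ∈ T, g ≠ e ∧ v ∈ g)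
    (hl : ∀ f ∈ T, ∀ u ∈ f, ∀ v ∈ f, u ≠ v → ∃ g ∈ T, g ≠ f ∧ (u ∈ g ∨ v ∈ g)) : False := by
  obtain ⟨a, b, c, hab, hac, hbc, rfl⟩ := Finset.card_eq_three.1 (hT.card_eq e he)
  have h : Tri T a b c := ⟨he, hab, hac, hbc⟩
  obtain ⟨f, hf, hfe, haf⟩ := he' a (by simp)
  obtain ⟨g, hg, hge, hbg⟩ := he' b (by simp)
  obtain ⟨k, hk, hke, hck⟩ := he' c (by simp)
  have key : ∀ {a b c : ℕ} {f k : Finset ℕ}, Tri T a b c → f ∈ T → f ≠ {a, b, c} → a ∈ f →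
      b ∈ f → k ∈ T → k ≠ {a, b, c} → c ∈ k → False := by
    intro a b c f k h hf hfe haf hbf hk hke hck
    obtain ⟨d, h', rfl⟩ := exists_tri_of_ne hf (hT.card_eq f hf) haf hbf h.ne₁₂
    exact hT.false_of_twin h h' (fun hcd => hfe (hcd ▸ rfl)) hk hck hke hl
  by_cases hfg : f = g
  · exact key h hf hfe haf (hfg ▸ hbg) hk hke hck
  by_cases hfk : f = k
  · rw [← triple_right_comm] at hfe hge
    exact key h.swap' hf hfe haf (hfk ▸ hck) hg hge hbg
  by_cases hgk : g = k
  · rw [Finset.insert_comm, ← triple_right_comm] at hfe hge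
    exact key h.swap.swap' hg hge hbg (hgk ▸ hck) hf hfe haf
  exact hT.false_of_spider h hf hg hk haf hbg hck hfe hge hke hfg hfk hgk

end TripleSystem

theorem mem_famU {T : Finset (Finset ℕ)} {v : ℕ} : v ∈ famU T ↔ ∃ f ∈ T, v ∈ f := by
  simp [famU, Finset.mem_sup]

namespace TripleSystem

variable {F T : Finset (Finset ℕ)}

theorem card_filter_le_two (hT : TripleSystem F T) (v : ℕ) : (T.filter (v ∈ ·)).card ≤ 2 := by
  by_contra! h
  obtain ⟨f, hf, g, hg, k, hk, hfg, hfk, hgk⟩ := Finset.two_lt_card.1 h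
  simp only [Finset.mem_filter] at hf hg hk
  exact hT.notMem hf.1 hg.1 hk.1 hf.2 hg.2 hfg hfk.symm hgk.symm hk.2

theorem two_mul_card_le (hT : TripleSystem F T)
    (h : ∀ e ∈ T, ∃ v ∈ e, ∀ g ∈ T, g ≠ e → v ∉ g) : 2 * T.card ≤ (famU T).card := by
  choose! p hp hp' using h
  have hinj : Set.InjOn p T := fun e he g hg heg => by
    by_contra hne
    exact hp' e he g hg (Ne.symm hne) (heg ▸ hp g hg)
  have hsub : T.image p ⊆ famU T := by
    simp only [Finset.subset_iff, Finset.mem_image]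
    rintro _ ⟨e, he, rfl⟩
    exact mem_famU.2 ⟨e, he, hp e he⟩
  have hcard := Finset.card_image_of_injOn hinj
  have hsum : ∑ v ∈ famU T, (T.filter (v ∈ ·)).card = ∑ f ∈ T, f.card := by
    refine (Finset.sum_card_bipartiteAbove_eq_sum_card_bipartiteBelow (· ∈ ·)).trans
      (Finset.sum_congr rfl fun f hf => congrArg _ ?_)
    ext v
    simp only [Finset.mem_bipartiteBelow, mem_famU, and_iff_right_iff_imp]
    exact fun hv => ⟨f, hf, hv⟩
  have hone : ∑ v ∈ T.image p, (T.filter (v ∈ ·)).card ≤ (T.image p).card • 1 := by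
    refine Finset.sum_le_card_nsmul _ _ _ fun v hv => ?_
    obtain ⟨e, he, rfl⟩ := Finset.mem_image.1 hv
    refine Finset.card_le_one.2 fun f hf g hg => ?_
    simp only [Finset.mem_filter] at hf hg
    have key : ∀ f ∈ T, p e ∈ f → f = e := fun f hf hpf => by_contra fun h => hp' e he f hf h hpf
    rw [key f hf.1 hf.2, key g hg.1 hg.2]
  have htwo := Finset.sum_le_card_nsmul (famU T \ T.image p) _ 2 fun v _ =>
    hT.card_filter_le_two v
  have hsplit := Finset.sum_sdiff hsub (f := fun v => (T.filter (v ∈ ·)).card)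
  have hsdiff := Finset.card_sdiff_add_card_eq_card hsub
  rw [hsum, Finset.sum_const_nat hT.card_eq] at hsplit
  simp only [smul_eq_mul] at hone htwo
  omega

theorem false_of_card (hT : TripleSystem F T) (hne : T.Nonempty)
    (hcard : (famU T).card < 2 * T.card) : False := by
  induction hm : T.card using Nat.strong_induction_on generalizing T with
  | _ m ih =>
    by_cases hl : ∀ f ∈ T, ∀ u ∈ f, ∀ v ∈ f, u ≠ v → ∃ g ∈ T, g ≠ f ∧ (u ∈ g ∨ v ∈ g)
    · by_cases h : ∀ e ∈ T, ∃ v ∈ e, ∀ g ∈ T, g ≠ e → v ∉ g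
      · have := hT.two_mul_card_le h
        omega
      · push Not at h
        obtain ⟨e, he, he'⟩ := h
        exact hT.false_of_linked he he' hl
    · push Not at hl
      obtain ⟨f, hf, u, hu, v, hv, huv, h⟩ := hl
      have hfU : f ⊆ famU T := fun w hw => mem_famU.2 ⟨f, hf, hw⟩
      have hsub : famU (T.erase f) ⊆ ((famU T).erase u).erase v := by
        intro w hw
        obtain ⟨g, hg, hwg⟩ := mem_famU.1 hw
        obtain ⟨hgf, hg⟩ := Finset.mem_erase.1 hg
        have := h g hg hgf
        simp only [Finset.mem_erase]
        exact ⟨fun hwv => this.2 (hwv ▸ hwg), fun hwu => this.1 (hwu ▸ hwg),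
          mem_famU.2 ⟨g, hg, hwg⟩⟩
      have hle := Finset.card_le_card hsub
      rw [Finset.card_erase_of_mem (by simp [huv.symm, hfU hv]),
        Finset.card_erase_of_mem (hfU hu)] at hle
      have h3 := Finset.card_le_card hfU
      rw [hT.card_eq f hf] at h3
      have hc := Finset.card_erase_of_mem hf
      refine ih (T.erase f).card ?_ ⟨hT.counterexample, (Finset.erase_subset f T).trans hT.subset,
        fun g hg => hT.card_eq g (Finset.mem_of_mem_erase hg)⟩ ?_ ?_ rfl
      · omega
      · rw [← Finset.card_pos]
        omega
      · omega

end TripleSystem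

theorem three_sets_theorem (T : Finset (Finset ℕ)) (h3 : ∀ S ∈ T, S.card = 3)
    (n : ℕ) (hn : 4 ≤ n) (hU : (famU T).card = n) (hcard : T.card ≥ n / 2 + 1)
    (F : Finset (Finset ℕ)) (hUC : UC F) (hTF : T ⊆ F) :
    ∃ i ∈ famU F, 2 * (memFam F i).card ≥ F.card := by
  by_contra! h
  have hne : T.Nonempty := Finset.card_pos.1 (by omega)
  have hF : Counterexample F := ⟨hUC, fun i => by
    by_cases hi : i ∈ famU F
    · exact h i hi
    · have : memFam F i = ∅ := Finset.filter_eq_empty_iff.2 fun S hS hiS =>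
        hi (mem_famU.2 ⟨S, hS, hiS⟩)
      simpa [this] using hne.mono hTF⟩
  exact TripleSystem.false_of_card ⟨hF, hTF, h3⟩ hne (by omega)
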